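/- arXiv:1408.4755 — 4 statements merged into one kernel-verified Lean document; each statement's English description precedes it below -/
import Mathlib

section
/- If X ~ CFUSN_{n,m}(μ, Σ, Δ), then H_X = (n/2)ln(2π) + (1/2)ln|Σ| + (1/2)Σᵢ E(X²_{i0}) − E[ln(2^m Φ_m(Δ'X₀ | I_m − Δ'Δ))], where X₀ ~ CFUSN_{n,m}(0, I_n, Δ) and X_{i0} is its i-th component. -/
open MeasureTheory Real Matrix

/-- Density of `N_k(0, V)` (for `V = 1` this is the standard `k`-variate normal density). -/
noncomputable def mvphi (k : ℕ) (V : Matrix (Fin k) (Fin k) ℝ) (z : Fin k → ℝ) : ℝ :=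
  (2 * Real.pi) ^ (-(k : ℝ) / 2) * (Real.sqrt V.det)⁻¹ * Real.exp (-(z ⬝ᵥ (V⁻¹ *ᵥ z)) / 2)

/-- CDF `Φ_k(x | V)` of `N_k(0, V)`. -/
noncomputable def mvPhi (k : ℕ) (V : Matrix (Fin k) (Fin k) ℝ) (x : Fin k → ℝ) : ℝ :=
  ∫ t in Set.Iic x, mvphi k V t

/-- Univariate standard normal density. -/
noncomputable def stdphi (x : ℝ) : ℝ := (Real.sqrt (2 * Real.pi))⁻¹ * Real.exp (-(x ^ 2) / 2)

/-- Univariate standard normal CDF `Φ`. -/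
noncomputable def stdPhi (x : ℝ) : ℝ := ∫ t in Set.Iic x, stdphi t

lemma aux_comp {n : ℕ} (B : Matrix (Fin n) (Fin n) ℝ) (hB : B.det ≠ 0) :
    ∃ e : (Fin n → ℝ) ≃ᵐ (Fin n → ℝ), (∀ x, e x = B *ᵥ x) ∧
      Measure.map e volume = ENNReal.ofReal |B.det⁻¹| • volume := by
  have hu : IsUnit B.det := isUnit_iff_ne_zero.mpr hB
  let e : (Fin n → ℝ) ≃ᵐ (Fin n → ℝ) :=
    { toFun := fun x => B *ᵥ x
      invFun := fun x => B⁻¹ *ᵥ x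
      left_inv := fun x => by simp [mulVec_mulVec, nonsing_inv_mul B hu]
      right_inv := fun x => by simp [mulVec_mulVec, mul_nonsing_inv B hu]
      measurable_toFun := Continuous.measurable (by fun_prop : Continuous fun x => B *ᵥ x)
      measurable_invFun := Continuous.measurable (by fun_prop : Continuous fun x => B⁻¹ *ᵥ x) }
  have he : ∀ x, e x = B *ᵥ x := fun x => rfl
  refine ⟨e, he, ?_⟩
  have h := Real.map_matrix_volume_pi_eq_smul_volume_pi hB
  have h' : (toLin' B : (Fin n → ℝ) → Fin n → ℝ) = e := by
    ext1 x; rw [he, toLin'_apply]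
  rwa [h'] at h

lemma aux_integral {n : ℕ} (B : Matrix (Fin n) (Fin n) ℝ) (hB : B.det ≠ 0)
    (F : (Fin n → ℝ) → ℝ) : ∫ x, F (B *ᵥ x) = |B.det|⁻¹ * ∫ x, F x := by
  obtain ⟨e, he, hm⟩ := aux_comp B hB
  have := integral_map_equiv (μ := volume) e F
  rw [hm, integral_smul_measure] at this
  simp only [he] at this
  rw [← this, ENNReal.toReal_ofReal (abs_nonneg _), abs_inv, smul_eq_mul]

lemma aux_integrable {n : ℕ} (B : Matrix (Fin n) (Fin n) ℝ) (hB : B.det ≠ 0)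
    (F : (Fin n → ℝ) → ℝ) (hF : Integrable F) : Integrable (fun x => F (B *ᵥ x)) := by
  obtain ⟨e, he, hm⟩ := aux_comp B hB
  have := (integrable_map_equiv (μ := volume) e F).1 (by
    rw [hm]; exact hF.smul_measure ENNReal.ofReal_ne_top)
  simpa only [Function.comp_def, he] using this

lemma aux_exp_prod {n : ℕ} (b : ℝ) (z : Fin n → ℝ) :
    exp (-b * (z ⬝ᵥ z)) = ∏ i, exp (-b * z i ^ 2) := by
  rw [← Real.exp_sum, dotProduct, Finset.mul_sum]
  congr 1
  exact Finset.sum_congr rfl fun i _ => by ring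

lemma aux_int_exp {n : ℕ} {b : ℝ} (hb : 0 < b) :
    Integrable (fun z : Fin n → ℝ => exp (-b * (z ⬝ᵥ z))) := by
  simp only [aux_exp_prod]
  exact Integrable.fintype_prod (f := fun _ x => exp (-b * x ^ 2)) (μ := fun _ => volume)
    fun i => integrable_exp_neg_mul_sq hb

lemma aux_integral_exp {n : ℕ} (b : ℝ) :
    ∫ z : Fin n → ℝ, exp (-b * (z ⬝ᵥ z)) = √(π / b) ^ n := by
  simp only [aux_exp_prod]
  rw [integral_fintype_prod_volume_eq_prod (fun _ x => exp (-b * x ^ 2))]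
  simp only [integral_gaussian, Finset.prod_const, Finset.card_univ, Fintype.card_fin]

lemma aux_integral_exp_Iic {n : ℕ} (b : ℝ) :
    ∫ z in Set.Iic (0 : Fin n → ℝ), exp (-b * (z ⬝ᵥ z)) = (√(π / b) / 2) ^ n := by
  simp only [aux_exp_prod]
  have h : Set.Iic (0 : Fin n → ℝ) = Set.univ.pi fun _ => Set.Iic 0 := by
    ext x; simp [Pi.le_def]
  rw [h, volume_pi, Measure.restrict_pi_pi,
    integral_fintype_prod_eq_prod (fun _ x => exp (-b * x ^ 2))]
  have : ∫ x in Set.Iic (0:ℝ), exp (-b * x ^ 2) = √(π / b) / 2 := by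
    have := integral_comp_neg_Iic (0:ℝ) (fun x => exp (-b * x ^ 2))
    simp only [neg_sq, neg_zero, integral_gaussian_Ioi] at this
    exact this
  rw [this]
  simp only [Finset.prod_const, Finset.card_univ, Fintype.card_fin]

open scoped MatrixOrder Matrix.Norms.L2Operator in
lemma aux_factor {n : ℕ} (M : Matrix (Fin n) (Fin n) ℝ) (hM : M.PosDef) :
    ∃ B : Matrix (Fin n) (Fin n) ℝ, B.det ≠ 0 ∧ |B.det| = √M.det ∧
      ∀ z, z ⬝ᵥ (M *ᵥ z) = (B *ᵥ z) ⬝ᵥ (B *ᵥ z) := by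
  obtain ⟨B, hB⟩ := CStarAlgebra.nonneg_iff_eq_star_mul_self.mp hM.posSemidef.nonneg
  have hB' : M = Bᵀ * B := by
    rw [hB, star_eq_conjTranspose, conjTranspose_eq_transpose_of_trivial]
  have hd : M.det = B.det ^ 2 := by rw [hB', det_mul, det_transpose, sq]
  refine ⟨B, ?_, ?_, ?_⟩
  · intro h; have := hM.det_pos; rw [hd, h] at this; simp at this
  · rw [hd, sqrt_sq_eq_abs]
  · intro z
    rw [hB', ← mulVec_mulVec, dotProduct_mulVec, vecMul_transpose]

lemma aux_gauss_int {n : ℕ} (M : Matrix (Fin n) (Fin n) ℝ) (hM : M.PosDef) :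
    Integrable (fun z : Fin n → ℝ => exp (-(z ⬝ᵥ (M *ᵥ z)) / 2)) := by
  obtain ⟨B, h1, h2, h3⟩ := aux_factor M hM
  have := aux_integrable B h1 _ (aux_int_exp (n := n) (b := 1/2) (by norm_num))
  refine this.congr (.of_forall fun z => ?_)
  simp only [h3]; congr 1; ring

lemma aux_gauss {n : ℕ} (M : Matrix (Fin n) (Fin n) ℝ) (hM : M.PosDef) :
    ∫ z : Fin n → ℝ, exp (-(z ⬝ᵥ (M *ᵥ z)) / 2) = (√M.det)⁻¹ * √(2 * π) ^ n := by
  obtain ⟨B, h1, h2, h3⟩ := aux_factor M hM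
  have := aux_integral B h1 (fun z => exp (-(1/2) * (z ⬝ᵥ z)))
  rw [aux_integral_exp, h2] at this
  rw [show 2 * π = π / (1/2) by ring, ← this]
  congr 1; ext z
  simp only [h3]; congr 1; ring

lemma aux_V {n m : ℕ} (Δ : Matrix (Fin n) (Fin m) ℝ)
    (hΔ : ∀ a : Fin m → ℝ, a ⬝ᵥ a = 1 → (Δ *ᵥ a) ⬝ᵥ (Δ *ᵥ a) < 1) :
    (1 - Δᵀ * Δ).PosDef := by
  refine PosDef.of_dotProduct_mulVec_pos ?_ ?_
  · simp [IsHermitian, conjTranspose_eq_transpose_of_trivial]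
  · intro x hx
    have hpos : 0 < x ⬝ᵥ x := by
      have h0 : 0 ≤ x ⬝ᵥ x := Finset.sum_nonneg fun i _ => mul_self_nonneg _
      exact lt_of_le_of_ne h0 fun h => hx (dotProduct_self_eq_zero.mp h.symm)
    have hs : √(x ⬝ᵥ x) * √(x ⬝ᵥ x) = x ⬝ᵥ x := Real.mul_self_sqrt hpos.le
    have hs0 : 0 < √(x ⬝ᵥ x) := Real.sqrt_pos.mpr hpos
    have h := hΔ ((√(x ⬝ᵥ x))⁻¹ • x) (by
      simp only [smul_dotProduct, dotProduct_smul, smul_eq_mul]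
      nth_rewrite 3 [← hs]
      field_simp)
    simp only [mulVec_smul, smul_dotProduct, dotProduct_smul, smul_eq_mul] at h
    have h2 : (Δ *ᵥ x) ⬝ᵥ (Δ *ᵥ x) < x ⬝ᵥ x := by
      rw [← mul_assoc, ← mul_inv, hs, inv_mul_lt_iff₀ hpos, mul_one] at h
      exact h
    rw [star_trivial, sub_mulVec, one_mulVec, dotProduct_sub, ← mulVec_mulVec,
      dotProduct_mulVec _ Δᵀ, vecMul_transpose]
    linarith

lemma aux_M {n m : ℕ} (Δ : Matrix (Fin n) (Fin m) ℝ) (hV : (1 - Δᵀ * Δ).PosDef) :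
    (1 + Δ * ((1 - Δᵀ * Δ)⁻¹ * Δᵀ)).PosDef := by
  have := hV.inv.posSemidef.mul_mul_conjTranspose_same Δ
  rw [conjTranspose_eq_transpose_of_trivial, Matrix.mul_assoc] at this
  exact PosDef.one.add_posSemidef this

lemma aux_detM {n m : ℕ} (Δ : Matrix (Fin n) (Fin m) ℝ) (hV : (1 - Δᵀ * Δ).PosDef) :
    (1 + Δ * ((1 - Δᵀ * Δ)⁻¹ * Δᵀ)).det = ((1 - Δᵀ * Δ).det)⁻¹ := by
  have hu : IsUnit (1 - Δᵀ * Δ).det := isUnit_iff_ne_zero.mpr hV.det_pos.ne'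
  rw [det_one_add_mul_comm]
  have : 1 + (1 - Δᵀ * Δ)⁻¹ * Δᵀ * Δ = (1 - Δᵀ * Δ)⁻¹ := by
    calc _ = (1 - Δᵀ * Δ)⁻¹ * (1 - Δᵀ * Δ) + (1 - Δᵀ * Δ)⁻¹ * (Δᵀ * Δ) := by
          rw [nonsing_inv_mul _ hu, Matrix.mul_assoc]
      _ = _ := by rw [← Matrix.mul_add, sub_add_cancel, Matrix.mul_one]
  rw [this, det_nonsing_inv, Ring.inverse_eq_inv']

lemma aux_quad {n m : ℕ} (Δ : Matrix (Fin n) (Fin m) ℝ) (hV : (1 - Δᵀ * Δ).PosDef)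
    (z : Fin n → ℝ) (t : Fin m → ℝ) :
    z ⬝ᵥ z + (t + Δᵀ *ᵥ z) ⬝ᵥ ((1 - Δᵀ * Δ)⁻¹ *ᵥ (t + Δᵀ *ᵥ z)) =
    t ⬝ᵥ t + (z + Δ *ᵥ t) ⬝ᵥ ((1 + Δ * ((1 - Δᵀ * Δ)⁻¹ * Δᵀ)) *ᵥ (z + Δ *ᵥ t)) := by
  have hu : IsUnit (1 - Δᵀ * Δ).det := isUnit_iff_ne_zero.mpr hV.det_pos.ne'
  obtain ⟨u, hu1⟩ : ∃ u, u = (1 - Δᵀ * Δ)⁻¹ *ᵥ (t + Δᵀ *ᵥ z) := ⟨_, rfl⟩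
  have hu2 : (1 - Δᵀ * Δ) *ᵥ u = t + Δᵀ *ᵥ z := by
    rw [hu1, mulVec_mulVec, mul_nonsing_inv _ hu, one_mulVec]
  have h1 : (1 - Δᵀ * Δ)⁻¹ *ᵥ (Δᵀ *ᵥ (z + Δ *ᵥ t)) = u - t := by
    have : Δᵀ *ᵥ (z + Δ *ᵥ t) = (1 - Δᵀ * Δ) *ᵥ (u - t) := by
      rw [mulVec_sub, hu2, sub_mulVec, one_mulVec, mulVec_add, mulVec_mulVec]
      abel
    rw [this, mulVec_mulVec, nonsing_inv_mul _ hu, one_mulVec]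
  have h2 : (1 + Δ * ((1 - Δᵀ * Δ)⁻¹ * Δᵀ)) *ᵥ (z + Δ *ᵥ t) = z + Δ *ᵥ u := by
    rw [add_mulVec, one_mulVec, ← mulVec_mulVec, ← mulVec_mulVec, h1, mulVec_sub]
    abel
  rw [h2, ← hu1]
  have h3 : (Δ *ᵥ t) ⬝ᵥ (Δ *ᵥ u) = t ⬝ᵥ u - t ⬝ᵥ t - t ⬝ᵥ (Δᵀ *ᵥ z) := by
    have : Δᵀ *ᵥ (Δ *ᵥ u) = u - t - Δᵀ *ᵥ z := by
      rw [sub_mulVec, one_mulVec] at hu2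
      rw [mulVec_mulVec, sub_sub, ← hu2]; abel
    rw [← dotProduct_sub, ← dotProduct_sub, ← this, dotProduct_mulVec t, vecMul_transpose]
  have h4 : t ⬝ᵥ (Δᵀ *ᵥ z) = (Δ *ᵥ t) ⬝ᵥ z := by rw [dotProduct_mulVec, vecMul_transpose]
  have h5 : (Δᵀ *ᵥ z) ⬝ᵥ u = z ⬝ᵥ (Δ *ᵥ u) := by
    rw [dotProduct_mulVec, mulVec_transpose]
  simp only [add_dotProduct, dotProduct_add]
  rw [h3, h4, h5]; ring

lemma aux_mvphi_one (k : ℕ) (z : Fin k → ℝ) :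
    mvphi k 1 z = (2 * π) ^ (-(k : ℝ) / 2) * exp (-(z ⬝ᵥ z) / 2) := by
  simp [mvphi]

lemma aux_rpow (k : ℕ) : (2 * π) ^ (-(k : ℝ) / 2) * √(2 * π) ^ k = 1 := by
  have h : (0:ℝ) < 2 * π := by positivity
  rw [Real.sqrt_eq_rpow, ← Real.rpow_natCast, ← Real.rpow_mul h.le, ← Real.rpow_add h]
  rw [show -(k:ℝ) / 2 + 1 / 2 * k = 0 by ring, Real.rpow_zero]

lemma aux_point {n m : ℕ} (Δ : Matrix (Fin n) (Fin m) ℝ) (hV : (1 - Δᵀ * Δ).PosDef)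
    (z : Fin n → ℝ) (t : Fin m → ℝ) :
    mvphi n 1 z * mvphi m (1 - Δᵀ * Δ) (t + Δᵀ *ᵥ z) =
      mvphi m 1 t * ((2 * π) ^ (-(n : ℝ) / 2) * (√(1 - Δᵀ * Δ).det)⁻¹) *
        exp (-((z + Δ *ᵥ t) ⬝ᵥ ((1 + Δ * ((1 - Δᵀ * Δ)⁻¹ * Δᵀ)) *ᵥ (z + Δ *ᵥ t))) / 2) := by
  have h := aux_quad Δ hV z t
  rw [aux_mvphi_one, aux_mvphi_one, mvphi]
  have e : exp (-(z ⬝ᵥ z) / 2) *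
      exp (-((t + Δᵀ *ᵥ z) ⬝ᵥ ((1 - Δᵀ * Δ)⁻¹ *ᵥ (t + Δᵀ *ᵥ z))) / 2) = exp (-(t ⬝ᵥ t) / 2) *
      exp (-((z + Δ *ᵥ t) ⬝ᵥ ((1 + Δ * ((1 - Δᵀ * Δ)⁻¹ * Δᵀ)) *ᵥ (z + Δ *ᵥ t))) / 2) := by
    rw [← Real.exp_add, ← Real.exp_add]; congr 1; linarith
  linear_combination ((2 * π) ^ (-(n : ℝ) / 2) * (2 * π) ^ (-(m : ℝ) / 2) *
    (√(1 - Δᵀ * Δ).det)⁻¹) * e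

lemma aux_J_int {n m : ℕ} (Δ : Matrix (Fin n) (Fin m) ℝ) (hV : (1 - Δᵀ * Δ).PosDef)
    (t : Fin m → ℝ) :
    Integrable (fun z => mvphi n 1 z * mvphi m (1 - Δᵀ * Δ) (t + Δᵀ *ᵥ z)) := by
  simp only [aux_point Δ hV]
  exact ((aux_gauss_int _ (aux_M Δ hV)).comp_add_right (Δ *ᵥ t)).const_mul _

lemma aux_J {n m : ℕ} (Δ : Matrix (Fin n) (Fin m) ℝ) (hV : (1 - Δᵀ * Δ).PosDef)
    (t : Fin m → ℝ) :
    ∫ z, mvphi n 1 z * mvphi m (1 - Δᵀ * Δ) (t + Δᵀ *ᵥ z) = mvphi m 1 t := by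
  simp only [aux_point Δ hV]
  rw [integral_const_mul, integral_add_right_eq_self (μ := volume) (fun z : Fin n → ℝ =>
    exp (-(z ⬝ᵥ ((1 + Δ * ((1 - Δᵀ * Δ)⁻¹ * Δᵀ)) *ᵥ z)) / 2)),
    aux_gauss _ (aux_M Δ hV), aux_detM Δ hV, Real.sqrt_inv, inv_inv]
  have h1 := aux_rpow n
  have h2 : (√(1 - Δᵀ * Δ).det)⁻¹ * √(1 - Δᵀ * Δ).det = 1 :=
    inv_mul_cancel₀ (Real.sqrt_pos.mpr hV.det_pos).ne'
  linear_combination (mvphi m 1 t * (√(1 - Δᵀ * Δ).det)⁻¹ * √(1 - Δᵀ * Δ).det) * h1 +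
    mvphi m 1 t * h2

lemma aux_mvphi_nonneg {k : ℕ} (V : Matrix (Fin k) (Fin k) ℝ) (z : Fin k → ℝ) :
    0 ≤ mvphi k V z := by
  unfold mvphi; positivity

lemma aux_mvphi_cont {k : ℕ} (V : Matrix (Fin k) (Fin k) ℝ) : Continuous (mvphi k V) := by
  unfold mvphi
  fun_prop

lemma aux_mvphi_int {k : ℕ} (V : Matrix (Fin k) (Fin k) ℝ) (hV : V.PosDef) :
    Integrable (mvphi k V) := (aux_gauss_int _ hV.inv).const_mul _

lemma aux_mvPhi_shift {k : ℕ} (V : Matrix (Fin k) (Fin k) ℝ) (x : Fin k → ℝ) :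
    mvPhi k V x = ∫ t in Set.Iic 0, mvphi k V (t + x) := by
  unfold mvPhi
  rw [← integral_indicator measurableSet_Iic, ← integral_indicator measurableSet_Iic,
    ← integral_add_right_eq_self (μ := volume) ((Set.Iic x).indicator fun t => mvphi k V t) x]
  congr 1; ext t
  have h : t + x ∈ Set.Iic x ↔ t ∈ Set.Iic 0 := by simp
  by_cases ht : t ∈ Set.Iic 0
  · rw [Set.indicator_of_mem ht, Set.indicator_of_mem (h.mpr ht)]
  · rw [Set.indicator_of_notMem ht, Set.indicator_of_notMem (fun h' => ht (h.mp h'))]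

lemma aux_mvPhi_meas {k : ℕ} (V : Matrix (Fin k) (Fin k) ℝ) : Measurable (mvPhi k V) := by
  have : mvPhi k V = fun x => ∫ t in Set.Iic 0, mvphi k V (t + x) :=
    funext (aux_mvPhi_shift V)
  rw [this]
  refine (StronglyMeasurable.integral_prod_right'
    (f := fun p : (Fin k → ℝ) × (Fin k → ℝ) => mvphi k V (p.2 + p.1)) ?_).measurable
  exact ((aux_mvphi_cont V).comp (by fun_prop)).stronglyMeasurable

lemma aux_mvPhi_nonneg {k : ℕ} (V : Matrix (Fin k) (Fin k) ℝ) (x : Fin k → ℝ) :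
    0 ≤ mvPhi k V x := integral_nonneg fun _ => aux_mvphi_nonneg V _

lemma aux_mvPhi_le {k : ℕ} (V : Matrix (Fin k) (Fin k) ℝ) (hV : V.PosDef) (x : Fin k → ℝ) :
    mvPhi k V x ≤ ∫ t, mvphi k V t :=
  setIntegral_le_integral (aux_mvphi_int V hV) (.of_forall fun _ => aux_mvphi_nonneg V _)

lemma aux_half (m : ℕ) : 2 ^ m * ∫ t in Set.Iic 0, mvphi m 1 t = 1 := by
  simp only [aux_mvphi_one]
  rw [integral_const_mul]
  have := aux_integral_exp_Iic (n := m) (1/2)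
  have e : ∀ t : Fin m → ℝ, exp (-(t ⬝ᵥ t) / 2) = exp (-(1/2) * (t ⬝ᵥ t)) := fun t => by
    congr 1; ring
  simp only [e]
  rw [this, show π / (1/2) = 2 * π by ring, div_pow]
  have h := aux_rpow m
  rw [← h]
  have h2 : (2:ℝ) ^ m ≠ 0 := by positivity
  rw [mul_div_assoc', mul_div_assoc', mul_comm, mul_div_cancel_right₀ _ h2]

lemma aux_total {n m : ℕ} (Δ : Matrix (Fin n) (Fin m) ℝ) (hV : (1 - Δᵀ * Δ).PosDef) :
    ∫ z, 2 ^ m * mvphi n 1 z * mvPhi m (1 - Δᵀ * Δ) (Δᵀ *ᵥ z) = 1 := by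
  simp only [mul_assoc]
  rw [integral_const_mul, ← aux_half m]
  congr 1
  simp only [aux_mvPhi_shift, ← integral_const_mul]
  rw [integral_integral_swap]
  · simp only [aux_J Δ hV]
  · refine (integrable_prod_iff' ?_).mpr ⟨.of_forall fun t => aux_J_int Δ hV t, ?_⟩
    · refine Continuous.aestronglyMeasurable ?_
      have h1 := aux_mvphi_cont (1 : Matrix (Fin n) (Fin n) ℝ)
      have h2 := aux_mvphi_cont (1 - Δᵀ * Δ)
      exact (h1.comp continuous_fst).mul (h2.comp (by fun_prop))
    · have : ∀ t : Fin m → ℝ, ∫ z, ‖Function.uncurry (fun (x : Fin n → ℝ) (y : Fin m → ℝ) =>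
          mvphi n 1 x * mvphi m (1 - Δᵀ * Δ) (y + Δᵀ *ᵥ x)) (z, t)‖ = mvphi m 1 t := by
        intro t
        rw [← aux_J Δ hV t]
        congr 1; ext z
        exact Real.norm_of_nonneg (mul_nonneg (aux_mvphi_nonneg _ _) (aux_mvphi_nonneg _ _))
      simp only [this]
      exact (aux_mvphi_int _ PosDef.one).restrict

/-- A bounded measurable function against the standard normal density is integrable. -/
lemma aux_bdd {n : ℕ} (G : (Fin n → ℝ) → ℝ) (hG : Measurable G) (C : ℝ) (hC : ∀ z, |G z| ≤ C) :
    Integrable (fun z => mvphi n 1 z * G z) :=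
  (aux_mvphi_int 1 PosDef.one).mul_bdd hG.aestronglyMeasurable (.of_forall hC)

lemma aux_sq_bdd {n : ℕ} (i : Fin n) (G : (Fin n → ℝ) → ℝ) (hG : Measurable G) (C : ℝ)
    (hC : ∀ z, |G z| ≤ C) :
    Integrable (fun z => z i ^ 2 * (mvphi n 1 z * G z)) := by
  have h : Integrable (fun z : Fin n → ℝ => z i ^ 2 * mvphi n 1 z) := by
    have h0 := (aux_int_exp (n := n) (b := 1/4) (by norm_num)).const_mul
      (4 * (2 * π) ^ (-(n : ℝ) / 2))
    refine h0.mono' ?_ (.of_forall fun z => ?_)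
    · have h1 := aux_mvphi_cont (1 : Matrix (Fin n) (Fin n) ℝ)
      exact Continuous.aestronglyMeasurable (by fun_prop)
    · rw [Real.norm_of_nonneg (mul_nonneg (sq_nonneg _) (aux_mvphi_nonneg _ _)), aux_mvphi_one]
      have h1 : z i ^ 2 ≤ z ⬝ᵥ z := by
        rw [sq]
        exact Finset.single_le_sum (f := fun j => z j * z j)
          (fun j _ => mul_self_nonneg _) (Finset.mem_univ i)
      have h2 : z i ^ 2 ≤ 4 * exp ((z ⬝ᵥ z) / 4) := by
        have := Real.add_one_le_exp ((z ⬝ᵥ z) / 4)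
        linarith
      have h3 : exp (-(1/4) * (z ⬝ᵥ z)) = exp ((z ⬝ᵥ z) / 4) * exp (-(z ⬝ᵥ z) / 2) := by
        rw [← Real.exp_add]; congr 1; ring
      rw [h3]
      have hp : 0 ≤ (2 * π) ^ (-(n : ℝ) / 2) * exp (-(z ⬝ᵥ z) / 2) := by positivity
      have := mul_le_mul_of_nonneg_right h2 hp
      linarith
  have := h.mul_bdd hG.aestronglyMeasurable (.of_forall hC)
  simpa only [mul_assoc] using this

/-- If `X ~ CFUSN_{n,m}(μ, Σ, Δ)` then
`H_X = (n/2)ln(2π) + (1/2)ln|Σ| + (1/2)Σᵢ E(X²_{i0}) − E[ln(2^m Φ_m(Δ'X₀ | I_m − Δ'Δ))]`,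
where `X₀ ~ CFUSN_{n,m}(0, I_n, Δ)`. -/
theorem entropy_CFUSN (n m : ℕ) (μ : Fin n → ℝ)
    (Sig S : Matrix (Fin n) (Fin n) ℝ) (hS : S.PosDef) (hSS : S * S = Sig)
    (Δ : Matrix (Fin n) (Fin m) ℝ)
    (hΔ : ∀ a : Fin m → ℝ, a ⬝ᵥ a = 1 → (Δ *ᵥ a) ⬝ᵥ (Δ *ᵥ a) < 1)
    (f f₀ : (Fin n → ℝ) → ℝ)
    (hf : ∀ w, f w = 2 ^ m * (Real.sqrt Sig.det)⁻¹ * mvphi n 1 (S⁻¹ *ᵥ (w - μ)) *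
      mvPhi m (1 - Δᵀ * Δ) (Δᵀ *ᵥ (S⁻¹ *ᵥ (w - μ))))
    (hf₀ : ∀ z, f₀ z = 2 ^ m * mvphi n 1 z * mvPhi m (1 - Δᵀ * Δ) (Δᵀ *ᵥ z)) :
    -∫ w, f w * Real.log (f w) =
      ((n : ℝ) / 2) * Real.log (2 * π) + (1 / 2) * Real.log Sig.det
        + (1 / 2) * ∑ i, (∫ z, (z i) ^ 2 * f₀ z)
        - ∫ z, f₀ z * Real.log (2 ^ m * mvPhi m (1 - Δᵀ * Δ) (Δᵀ *ᵥ z)) := by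
  have hV := aux_V Δ hΔ
  have hd : 0 < S.det := hS.det_pos
  have hSig : Sig.det = S.det ^ 2 := by rw [← hSS, det_mul, sq]
  have hsq : √Sig.det = S.det := by rw [hSig, Real.sqrt_sq hd.le]
  have hlog : Real.log Sig.det = 2 * Real.log S.det := by rw [hSig, Real.log_pow]; norm_num
  -- the function `G = 2 ^ m * Φ`
  obtain ⟨G, hG⟩ : ∃ G : (Fin n → ℝ) → ℝ, ∀ z, G z =
    2 ^ m * mvPhi m (1 - Δᵀ * Δ) (Δᵀ *ᵥ z) := ⟨_, fun _ => rfl⟩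
  have hG0 : ∀ z, 0 ≤ G z := fun z => by
    rw [hG]; exact mul_nonneg (by positivity) (aux_mvPhi_nonneg _ _)
  have hGm : Measurable G := by
    rw [funext hG]
    exact ((aux_mvPhi_meas _).comp
      (Continuous.measurable (by fun_prop : Continuous fun z => Δᵀ *ᵥ z))).const_mul _
  obtain ⟨C, hC⟩ : ∃ C, ∀ z, G z ≤ C := ⟨2 ^ m * ∫ t, mvphi m (1 - Δᵀ * Δ) t, fun z => by
    rw [hG]; exact mul_le_mul_of_nonneg_left (aux_mvPhi_le _ hV _) (by positivity)⟩
  have hCabs : ∀ z, |G z| ≤ C := fun z => by rw [abs_of_nonneg (hG0 z)]; exact hC z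
  have hf0 : ∀ z, f₀ z = mvphi n 1 z * G z := fun z => by rw [hf₀, hG]; ring
  obtain ⟨D, hD⟩ : ∃ D, ∀ z, |G z * Real.log (G z)| ≤ D := by
    obtain ⟨D, hD⟩ := (isCompact_Icc (a := (0:ℝ)) (b := C)).exists_bound_of_continuousOn
      Real.continuous_mul_log.continuousOn
    exact ⟨D, fun z => hD _ ⟨hG0 z, hC z⟩⟩
  have hi0 : Integrable f₀ := by
    rw [funext hf0]; exact aux_bdd G hGm C hCabs
  have hi2 : ∀ i, Integrable (fun z => z i ^ 2 * f₀ z) := fun i => by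
    simp only [hf0]; exact aux_sq_bdd i G hGm C hCabs
  have hil : Integrable (fun z => f₀ z * Real.log (G z)) := by
    simp only [hf0, mul_assoc]
    exact aux_bdd _ (hGm.mul (Real.measurable_log.comp hGm)) D hD
  have htot : ∫ z, f₀ z = 1 := by
    rw [← aux_total Δ hV]; exact integral_congr_ae (.of_forall hf₀)
  -- change of variables
  have hchange : ∫ w, f w * Real.log (f w) = ∫ z, f₀ z * Real.log (S.det⁻¹ * f₀ z) := by
    have e : ∀ w, f w * Real.log (f w) = (fun x => (fun z => S.det⁻¹ * f₀ z *
        Real.log (S.det⁻¹ * f₀ z)) (S⁻¹ *ᵥ x)) (w - μ) := fun w => by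
      have : f w = S.det⁻¹ * f₀ (S⁻¹ *ᵥ (w - μ)) := by rw [hf, hf₀, hsq]; ring
      simp only [this]
    rw [integral_congr_ae (.of_forall e), integral_sub_right_eq_self (μ := volume)
      (fun x => (fun z => S.det⁻¹ * f₀ z * Real.log (S.det⁻¹ * f₀ z)) (S⁻¹ *ᵥ x)) μ,
      aux_integral S⁻¹ ?_ (fun z => S.det⁻¹ * f₀ z * Real.log (S.det⁻¹ * f₀ z))]
    · rw [det_nonsing_inv, Ring.inverse_eq_inv', abs_of_pos (inv_pos.mpr hd), inv_inv]
      simp only [mul_assoc]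
      rw [integral_const_mul, ← mul_assoc, mul_inv_cancel₀ hd.ne', one_mul]
    · rw [det_nonsing_inv, Ring.inverse_eq_inv']; exact inv_ne_zero hd.ne'
  have hpt : ∀ z, f₀ z * Real.log (S.det⁻¹ * f₀ z) =
      (-(Real.log S.det) - (n : ℝ) / 2 * Real.log (2 * π)) * f₀ z
        - (1 / 2) * (∑ i, z i ^ 2 * f₀ z) + f₀ z * Real.log (G z) := by
    intro z
    rw [← Finset.sum_mul]
    by_cases hz : G z = 0
    · simp [hf0, hz]
    · have hsum : z ⬝ᵥ z = ∑ i, z i ^ 2 := Finset.sum_congr rfl fun i _ => (sq _).symm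
      have h2 : (0:ℝ) < 2 * π := by positivity
      have hp : (0:ℝ) < (2 * π) ^ (-(n : ℝ) / 2) := Real.rpow_pos_of_pos h2 _
      have : Real.log (S.det⁻¹ * f₀ z) = -(Real.log S.det) +
          ((-(n : ℝ) / 2) * Real.log (2 * π) + -(z ⬝ᵥ z) / 2 + Real.log (G z)) := by
        rw [hf0, aux_mvphi_one, Real.log_mul (inv_ne_zero hd.ne') (by positivity),
          Real.log_mul (by positivity) hz, Real.log_mul hp.ne' (Real.exp_ne_zero _),
          Real.log_inv, Real.log_rpow h2, Real.log_exp]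
      rw [this, ← hsum]; ring
  rw [hchange, integral_congr_ae (.of_forall hpt), integral_add, integral_sub,
    integral_const_mul, integral_const_mul, integral_finsetSum, htot, hlog]
  · simp only [← hG]; ring
  · exact fun i _ => hi2 i
  · exact hi0.const_mul _
  · exact (integrable_finsetSum _ fun i _ => hi2 i).const_mul _
  · exact (hi0.const_mul _).sub ((integrable_finsetSum _ fun i _ => hi2 i).const_mul _)
  · exact hil
end

section
/- If Z ~ CFUSN_{n,m}(μ, Σ, Δ) where Δ'Δ is a diagonal m×m matrix and Σ is a covariance matrix, then H_Z = H_{N_n(μ,Σ)} − E[ln(2^m Φ_m(Δ'X₀ | I_m − Δ'Δ))], with X₀ ~ CFUSN_{n,m}(0, I_n, Δ). -/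
open MeasureTheory Real Matrix

open ProbabilityTheory in
/-- Gaussian CDF with variance `v`. -/
noncomputable def gcdf (v : NNReal) (x : ℝ) : ℝ := ∫ t in Set.Iic x, gaussianPDFReal 0 v t

open ProbabilityTheory in
lemma mvphi_diag (k : ℕ) (v : Fin k → NNReal) (hv : ∀ i, v i ≠ 0) (z : Fin k → ℝ) :
    mvphi k (Matrix.diagonal fun i => (v i : ℝ)) z = ∏ i, gaussianPDFReal 0 (v i) (z i) := by
  have hv' : ∀ i, (v i : ℝ) ≠ 0 := fun i => by exact_mod_cast hv i
  have hinv : (Matrix.diagonal fun i => (v i : ℝ))⁻¹ = Matrix.diagonal fun i => (v i : ℝ)⁻¹ := by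
    apply Matrix.inv_eq_right_inv
    rw [Matrix.diagonal_mul_diagonal]
    simp [hv']
  have hpi : (2 * Real.pi) ^ (-(k : ℝ) / 2) = ∏ _i : Fin k, (Real.sqrt (2 * Real.pi))⁻¹ := by
    rw [Finset.prod_const, Finset.card_univ, Fintype.card_fin, Real.sqrt_eq_rpow,
      ← Real.rpow_neg (by positivity), ← Real.rpow_natCast, ← Real.rpow_mul (by positivity)]
    congr 1
    ring
  unfold mvphi
  rw [hinv, Matrix.det_diagonal, Real.sqrt_prod _ (fun i _ => NNReal.coe_nonneg (v i)), hpi, ← Finset.prod_inv_distrib,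
    ← Finset.prod_mul_distrib]
  have : -(z ⬝ᵥ (Matrix.diagonal (fun i => (v i : ℝ)⁻¹) *ᵥ z)) / 2
      = ∑ i, -(z i - 0) ^ 2 / (2 * (v i : ℝ)) := by
    simp only [dotProduct, Matrix.mulVec_diagonal]
    rw [← Finset.sum_neg_distrib, Finset.sum_div]
    refine Finset.sum_congr rfl fun i _ => ?_
    have := hv' i
    field_simp
    ring
  rw [this, Real.exp_sum, ← Finset.prod_mul_distrib]
  refine Finset.prod_congr rfl fun i _ => ?_
  rw [gaussianPDFReal, Real.sqrt_mul (by positivity) (v i : ℝ), mul_inv]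

lemma mvPhi_diag (k : ℕ) (v : Fin k → NNReal) (hv : ∀ i, v i ≠ 0) (x : Fin k → ℝ) :
    mvPhi k (Matrix.diagonal fun i => (v i : ℝ)) x = ∏ i, gcdf (v i) (x i) := by
  unfold mvPhi gcdf
  simp_rw [mvphi_diag k v hv]
  rw [← Set.pi_univ_Iic, volume_pi, Measure.restrict_pi_pi]
  exact integral_fintype_prod_eq_prod (fun i t => ProbabilityTheory.gaussianPDFReal 0 (v i) t)

lemma gcdf_nonneg (v : NNReal) (x : ℝ) : 0 ≤ gcdf v x :=
  integral_nonneg fun _ => ProbabilityTheory.gaussianPDFReal_nonneg _ _ _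

lemma gcdf_neg (v : NNReal) (hv : v ≠ 0) (x : ℝ) : gcdf v (-x) = 1 - gcdf v x := by
  have h1 := integral_comp_neg_Iic (-x) (ProbabilityTheory.gaussianPDFReal 0 v)
  have h2 := intervalIntegral.integral_Iic_add_Ioi
    ((ProbabilityTheory.integrable_gaussianPDFReal 0 v).integrableOn (s := Set.Iic x))
    (ProbabilityTheory.integrable_gaussianPDFReal 0 v).integrableOn
  rw [ProbabilityTheory.integral_gaussianPDFReal_eq_one 0 hv] at h2
  simp only [neg_neg] at h1
  have h3 : ∀ t, ProbabilityTheory.gaussianPDFReal 0 v (-t)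
      = ProbabilityTheory.gaussianPDFReal 0 v t := by
    intro t; simp [ProbabilityTheory.gaussianPDFReal]
  simp_rw [h3] at h1
  unfold gcdf
  linarith

lemma gcdf_le_one (v : NNReal) (hv : v ≠ 0) (x : ℝ) : gcdf v x ≤ 1 := by
  have := gcdf_neg v hv x
  have := gcdf_nonneg v (-x)
  linarith

lemma gcdf_measurable (v : NNReal) : Measurable (gcdf v) := by
  apply Monotone.measurable
  intro x y hxy
  exact setIntegral_mono_set (ProbabilityTheory.integrable_gaussianPDFReal 0 v).integrableOn
    (Filter.Eventually.of_forall fun _ => ProbabilityTheory.gaussianPDFReal_nonneg _ _ _)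
    (Set.Iic_subset_Iic.2 hxy).eventuallyLE

lemma integral_comp_mulVec {n : ℕ} (M : Matrix (Fin n) (Fin n) ℝ) (hM : M.det ≠ 0)
    (g : (Fin n → ℝ) → ℝ) : ∫ z, g (M *ᵥ z) = |M.det|⁻¹ * ∫ z, g z := by
  have h := Real.map_matrix_volume_pi_eq_smul_volume_pi hM
  have hinj : Function.Injective (Matrix.toLin' M) :=
    Matrix.mulVec_injective_of_isUnit ((Matrix.isUnit_iff_isUnit_det M).2 (isUnit_iff_ne_zero.2 hM))
  have hc : Continuous (Matrix.toLin' M) := LinearMap.continuous_of_finiteDimensional _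
  have he := hc.measurableEmbedding hinj
  have h2 := he.integral_map (μ := volume) g
  rw [h, integral_smul_measure, ENNReal.toReal_ofReal (abs_nonneg _), abs_inv] at h2
  simpa using h2.symm

/-- Reflection along `d`. -/
noncomputable def reflM {n : ℕ} (d : Fin n → ℝ) : Matrix (Fin n) (Fin n) ℝ :=
  1 - (2 / (d ⬝ᵥ d)) • Matrix.vecMulVec d d

lemma refl_mulVec {n : ℕ} (d z : Fin n → ℝ) :
    reflM d *ᵥ z = z - (2 / (d ⬝ᵥ d) * (d ⬝ᵥ z)) • d := by
  unfold reflM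
  rw [Matrix.sub_mulVec, Matrix.one_mulVec, Matrix.smul_mulVec, Matrix.vecMulVec_mulVec]
  ext i
  simp
  ring

lemma refl_dot {n : ℕ} (d z : Fin n → ℝ) : d ⬝ᵥ (reflM d *ᵥ z) = -(d ⬝ᵥ z) := by
  rw [refl_mulVec, dotProduct_sub, dotProduct_smul, smul_eq_mul]
  by_cases h : d ⬝ᵥ d = 0
  · have : d = 0 := dotProduct_self_eq_zero.1 h
    simp [this]
  · field_simp
    ring

lemma refl_dot_orth {n : ℕ} (d e z : Fin n → ℝ) (h : e ⬝ᵥ d = 0) :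
    e ⬝ᵥ (reflM d *ᵥ z) = e ⬝ᵥ z := by
  rw [refl_mulVec, dotProduct_sub, dotProduct_smul, smul_eq_mul, h]
  simp

lemma refl_refl {n : ℕ} (d z : Fin n → ℝ) : reflM d *ᵥ (reflM d *ᵥ z) = z := by
  rw [refl_mulVec d (reflM d *ᵥ z), refl_dot, refl_mulVec]
  ext i
  simp

lemma refl_det {n : ℕ} (d : Fin n → ℝ) : |(reflM d).det| = 1 := by
  have : reflM d * reflM d = 1 := by
    apply Matrix.ext_of_mulVec_single
    intro i
    rw [← Matrix.mulVec_mulVec, refl_refl, Matrix.one_mulVec]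
  have h := congrArg Matrix.det this
  rw [Matrix.det_mul, Matrix.det_one] at h
  exact (abs_eq zero_le_one).2 (mul_self_eq_one_iff.1 h)

lemma refl_norm {n : ℕ} (d z : Fin n → ℝ) : (reflM d *ᵥ z) ⬝ᵥ (reflM d *ᵥ z) = z ⬝ᵥ z := by
  have h1 := refl_dot d z
  set y := reflM d *ᵥ z with hy
  have : y = z - (2 / (d ⬝ᵥ d) * (d ⬝ᵥ z)) • d := refl_mulVec d z
  have h2 : y ⬝ᵥ y = y ⬝ᵥ (z - (2 / (d ⬝ᵥ d) * (d ⬝ᵥ z)) • d) := by rw [← this]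
  rw [h2, dotProduct_sub, dotProduct_smul, dotProduct_comm y d, h1, dotProduct_comm y z]
  rw [this, dotProduct_sub, dotProduct_smul, dotProduct_comm z d]
  simp

/-- The product of CDF factors over `s`. -/
noncomputable def PP {n m : ℕ} (v : Fin m → NNReal) (Δ : Matrix (Fin n) (Fin m) ℝ)
    (s : Finset (Fin m)) (z : Fin n → ℝ) : ℝ := ∏ j ∈ s, (2 * gcdf (v j) (Δ.col j ⬝ᵥ z))

lemma PP_measurable {n m : ℕ} (v : Fin m → NNReal) (Δ : Matrix (Fin n) (Fin m) ℝ)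
    (s : Finset (Fin m)) : Measurable (PP v Δ s) := by
  unfold PP
  refine Finset.measurable_fun_prod _ fun j _ => ?_
  refine ((gcdf_measurable (v j)).comp ?_).const_mul 2
  unfold dotProduct
  fun_prop

lemma PP_nonneg {n m : ℕ} (v : Fin m → NNReal) (Δ : Matrix (Fin n) (Fin m) ℝ)
    (s : Finset (Fin m)) (z : Fin n → ℝ) : 0 ≤ PP v Δ s z :=
  Finset.prod_nonneg fun j _ => mul_nonneg zero_le_two (gcdf_nonneg _ _)

lemma PP_le {n m : ℕ} (v : Fin m → NNReal) (hv : ∀ i, v i ≠ 0) (Δ : Matrix (Fin n) (Fin m) ℝ)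
    (s : Finset (Fin m)) (z : Fin n → ℝ) : PP v Δ s z ≤ 2 ^ s.card := by
  rw [← Finset.prod_const]
  refine Finset.prod_le_prod (fun j _ => mul_nonneg zero_le_two (gcdf_nonneg _ _)) fun j _ => ?_
  have := gcdf_le_one (v j) (hv j) (Δ.col j ⬝ᵥ z)
  linarith

lemma PP_integrable {n m : ℕ} (v : Fin m → NNReal) (hv : ∀ i, v i ≠ 0)
    (Δ : Matrix (Fin n) (Fin m) ℝ) (s : Finset (Fin m)) (w : (Fin n → ℝ) → ℝ)
    (hw : Integrable w) : Integrable fun z => w z * PP v Δ s z := by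
  refine hw.mul_bdd (c := 2 ^ s.card) (PP_measurable v Δ s).aestronglyMeasurable
    (Filter.Eventually.of_forall fun z => ?_)
  rw [Real.norm_eq_abs, abs_of_nonneg (PP_nonneg _ _ _ _)]
  exact PP_le v hv Δ s z

lemma PP_integral {n m : ℕ} (v : Fin m → NNReal) (hv : ∀ i, v i ≠ 0)
    (Δ : Matrix (Fin n) (Fin m) ℝ) (horth : ∀ i j, i ≠ j → Δ.col i ⬝ᵥ Δ.col j = 0)
    (h : ℝ → ℝ) (hw : Integrable fun z : Fin n → ℝ => h (z ⬝ᵥ z)) (s : Finset (Fin m)) :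
    ∫ z : Fin n → ℝ, h (z ⬝ᵥ z) * PP v Δ s z = ∫ z : Fin n → ℝ, h (z ⬝ᵥ z) := by
  induction s using Finset.induction_on with
  | empty => simp [PP]
  | insert j s hj ih =>
    have hI := PP_integrable v hv Δ s _ hw
    have hI2 := PP_integrable v hv Δ (insert j s) _ hw
    have hdet : (reflM (Δ.col j)).det ≠ 0 := by
      intro h0
      have := refl_det (Δ.col j)
      rw [h0] at this
      simp at this
    have key := integral_comp_mulVec (reflM (Δ.col j)) hdet
      (fun z => h (z ⬝ᵥ z) * PP v Δ (insert j s) z)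
    rw [refl_det, inv_one, one_mul] at key
    have hpt : ∀ z, h ((reflM (Δ.col j) *ᵥ z) ⬝ᵥ (reflM (Δ.col j) *ᵥ z))
        * PP v Δ (insert j s) (reflM (Δ.col j) *ᵥ z)
        = 2 * (h (z ⬝ᵥ z) * PP v Δ s z) - h (z ⬝ᵥ z) * PP v Δ (insert j s) z := by
      intro z
      have hs : PP v Δ s (reflM (Δ.col j) *ᵥ z) = PP v Δ s z := by
        refine Finset.prod_congr rfl fun i hi => ?_
        rw [refl_dot_orth _ _ _ (horth i j (fun e => hj (e ▸ hi)))]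
      have hins : ∀ y, PP v Δ (insert j s) y = 2 * gcdf (v j) (Δ.col j ⬝ᵥ y) * PP v Δ s y :=
        fun y => Finset.prod_insert hj
      rw [refl_norm, hins, hins, hs, refl_dot, gcdf_neg _ (hv j)]
      ring
    simp_rw [hpt] at key
    rw [integral_sub (hI.const_mul 2) hI2, integral_const_mul, ih] at key
    linarith

open ProbabilityTheory in
lemma phi_eq_prod (n : ℕ) (z : Fin n → ℝ) : mvphi n 1 z = ∏ i, gaussianPDFReal 0 1 (z i) := by
  have := mvphi_diag n (fun _ => 1) (fun _ => one_ne_zero) z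
  simpa using this

lemma phi_integrable (n : ℕ) : Integrable (mvphi n 1) := by
  have : mvphi n 1 = fun z => ∏ i, ProbabilityTheory.gaussianPDFReal 0 1 (z i) :=
    funext (phi_eq_prod n)
  rw [this]
  exact Integrable.fintype_prod (f := fun _ => ProbabilityTheory.gaussianPDFReal 0 1)
    (fun _ => ProbabilityTheory.integrable_gaussianPDFReal 0 1)

lemma phi_integral (n : ℕ) : ∫ z, mvphi n 1 z = 1 := by
  simp_rw [phi_eq_prod]
  rw [integral_fintype_prod_volume_eq_prod (fun _ => ProbabilityTheory.gaussianPDFReal 0 1)]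
  simp [ProbabilityTheory.integral_gaussianPDFReal_eq_one 0 (one_ne_zero : (1 : NNReal) ≠ 0)]

open ProbabilityTheory in
lemma sq_gauss_integrable : Integrable fun x : ℝ => x ^ 2 * gaussianPDFReal 0 1 x := by
  have := (integrable_rpow_mul_exp_neg_mul_sq (b := 1/2) (by norm_num) (s := 2) (by norm_num)).const_mul
    (Real.sqrt (2 * Real.pi))⁻¹
  refine this.congr (Filter.Eventually.of_forall fun x => ?_)
  simp only [gaussianPDFReal, Real.rpow_ofNat]
  simp
  ring_nf

open ProbabilityTheory in
lemma sq_gauss_integral : ∫ x : ℝ, x ^ 2 * gaussianPDFReal 0 1 x = 1 := by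
  have h := variance_id_gaussianReal (μ := 0) (v := 1)
  rw [variance_of_integral_eq_zero (by fun_prop) (by simp),
    integral_gaussianReal_eq_integral_smul one_ne_zero] at h
  simp only [smul_eq_mul, id, NNReal.coe_one] at h
  simpa [mul_comm] using h

open ProbabilityTheory in
lemma coord_prod (n : ℕ) (i : Fin n) (z : Fin n → ℝ) : z i ^ 2 * mvphi n 1 z =
    ∏ k, (if k = i then fun x : ℝ => x ^ 2 * gaussianPDFReal 0 1 x else gaussianPDFReal 0 1)
      (z k) := by
  rw [phi_eq_prod, ← Finset.mul_prod_erase _ _ (Finset.mem_univ i),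
    ← Finset.mul_prod_erase Finset.univ (fun k => (if k = i then fun x : ℝ =>
      x ^ 2 * gaussianPDFReal 0 1 x else gaussianPDFReal 0 1) (z k)) (Finset.mem_univ i)]
  simp only [if_true, mul_assoc]
  congr 2
  refine Finset.prod_congr rfl fun k hk => ?_
  rw [if_neg (Finset.ne_of_mem_erase hk)]

open ProbabilityTheory in
lemma coord_integrable (n : ℕ) (i : Fin n) :
    Integrable fun z : Fin n → ℝ => z i ^ 2 * mvphi n 1 z := by
  simp_rw [coord_prod]
  refine Integrable.fintype_prod (f := fun k => if k = i then fun x : ℝ =>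
    x ^ 2 * gaussianPDFReal 0 1 x else gaussianPDFReal 0 1) fun k => ?_
  split_ifs
  · exact sq_gauss_integrable
  · exact integrable_gaussianPDFReal 0 1

open ProbabilityTheory in
lemma coord_integral (n : ℕ) (i : Fin n) :
    ∫ z : Fin n → ℝ, z i ^ 2 * mvphi n 1 z = 1 := by
  simp_rw [coord_prod]
  rw [integral_fintype_prod_volume_eq_prod (fun k => if k = i then fun x : ℝ =>
    x ^ 2 * gaussianPDFReal 0 1 x else gaussianPDFReal 0 1)]
  refine Finset.prod_eq_one fun k _ => ?_
  split_ifs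
  · exact sq_gauss_integral
  · exact integral_gaussianPDFReal_eq_one 0 one_ne_zero

lemma norm_phi_eq (n : ℕ) (z : Fin n → ℝ) :
    (z ⬝ᵥ z) * mvphi n 1 z = ∑ i, z i ^ 2 * mvphi n 1 z := by
  rw [dotProduct, Finset.sum_mul]
  simp_rw [sq]

lemma norm_phi_integrable (n : ℕ) :
    Integrable fun z : Fin n → ℝ => (z ⬝ᵥ z) * mvphi n 1 z := by
  simp_rw [norm_phi_eq]
  exact integrable_finsetSum _ fun i _ => coord_integrable n i

lemma norm_phi_integral (n : ℕ) :
    ∫ z : Fin n → ℝ, (z ⬝ᵥ z) * mvphi n 1 z = n := by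
  simp_rw [norm_phi_eq]
  rw [integral_finsetSum _ fun i _ => coord_integrable n i]
  simp [coord_integral]

lemma phi_radial (n : ℕ) (z : Fin n → ℝ) :
    mvphi n 1 z = (2 * Real.pi) ^ (-(n : ℝ) / 2) * Real.exp (-(z ⬝ᵥ z) / 2) := by
  simp [mvphi]

lemma log_phi (n : ℕ) (z : Fin n → ℝ) :
    Real.log (mvphi n 1 z) = -((n : ℝ) / 2) * Real.log (2 * π) - (z ⬝ᵥ z) / 2 := by
  rw [phi_radial, Real.log_mul (by positivity) (by positivity), Real.log_rpow (by positivity),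
    Real.log_exp]
  ring

lemma mul_log_mul (x y : ℝ) :
    (x * y) * Real.log (x * y) = y * (x * Real.log x) + x * (y * Real.log y) := by
  have := Real.negMulLog_mul x y
  simp only [Real.negMulLog] at this
  linarith

theorem entropy_CFUSN_diag (n m : ℕ) (μ : Fin n → ℝ)
    (Sig S : Matrix (Fin n) (Fin n) ℝ) (hS : S.PosDef) (hSS : S * S = Sig)
    (hSig : Sig.PosDef)
    (Δ : Matrix (Fin n) (Fin m) ℝ)
    (hΔ : ∀ a : Fin m → ℝ, a ⬝ᵥ a = 1 → (Δ *ᵥ a) ⬝ᵥ (Δ *ᵥ a) < 1)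
    (hdiag : (Δᵀ * Δ).IsDiag)
    (f f₀ : (Fin n → ℝ) → ℝ)
    (hf : ∀ w, f w = 2 ^ m * (Real.sqrt Sig.det)⁻¹ * mvphi n 1 (S⁻¹ *ᵥ (w - μ)) *
      mvPhi m (1 - Δᵀ * Δ) (Δᵀ *ᵥ (S⁻¹ *ᵥ (w - μ))))
    (hf₀ : ∀ z, f₀ z = 2 ^ m * mvphi n 1 z * mvPhi m (1 - Δᵀ * Δ) (Δᵀ *ᵥ z)) :
    -∫ w, f w * Real.log (f w) =
      ((1 / 2) * Real.log Sig.det + ((n : ℝ) / 2) * (1 + Real.log (2 * π)))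
        - ∫ z, f₀ z * Real.log (2 ^ m * mvPhi m (1 - Δᵀ * Δ) (Δᵀ *ᵥ z)) := by
  have hentry : ∀ i j, (Δᵀ * Δ) i j = Δ.col i ⬝ᵥ Δ.col j := fun i j => rfl
  have horth : ∀ i j, i ≠ j → Δ.col i ⬝ᵥ Δ.col j = 0 := fun i j hij => hdiag hij
  have hlt : ∀ j, Δ.col j ⬝ᵥ Δ.col j < 1 := by
    intro j
    have := hΔ (Pi.single j 1) (by simp)
    rwa [Matrix.mulVec_single_one] at this
  obtain ⟨v, hv⟩ : ∃ v : Fin m → NNReal, ∀ j, (v j : ℝ) = 1 - Δ.col j ⬝ᵥ Δ.col j :=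
    ⟨fun j => ⟨1 - Δ.col j ⬝ᵥ Δ.col j, by linarith [hlt j]⟩, fun j => rfl⟩
  have hv0 : ∀ j, v j ≠ 0 := by
    intro j h0
    have := hv j
    rw [h0] at this
    have := hlt j
    simp at *
    linarith
  have hV : 1 - Δᵀ * Δ = Matrix.diagonal fun j => (v j : ℝ) := by
    ext i j
    by_cases hij : i = j
    · subst hij
      simp [hv, hentry]
    · have := hdiag hij
      simp only [Matrix.sub_apply, this, Matrix.diagonal_apply_ne _ hij, Matrix.one_apply_ne hij,
        sub_zero]
  have hG : ∀ z : Fin n → ℝ, 2 ^ m * mvPhi m (1 - Δᵀ * Δ) (Δᵀ *ᵥ z) = PP v Δ Finset.univ z := by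
    intro z
    rw [hV, mvPhi_diag m v hv0, PP, Finset.prod_mul_distrib]
    simp only [Finset.prod_const, Finset.card_univ, Fintype.card_fin]
    rfl
  set G := PP v Δ Finset.univ with hGdef
  have hf₀' : ∀ z, f₀ z = mvphi n 1 z * G z := by
    intro z; rw [hf₀, ← hG]; ring
  have hdet : 0 < S.det := hS.det_pos
  have hsq : Real.sqrt Sig.det = S.det := by
    rw [← hSS, Matrix.det_mul, Real.sqrt_mul_self hdet.le]
  have hf' : ∀ w, f w = S.det⁻¹ * f₀ (S⁻¹ *ᵥ (w - μ)) := by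
    intro w; rw [hf, hf₀, hsq]; ring
  have hlogdet : (1 / 2) * Real.log Sig.det = Real.log S.det := by
    rw [← hSS, Matrix.det_mul, Real.log_mul hdet.ne' hdet.ne']; ring
  have hinvdet : S⁻¹.det = S.det⁻¹ := by rw [Matrix.det_nonsing_inv, Ring.inverse_eq_inv']
  have hcv : ∫ w, f w * Real.log (f w)
      = ∫ z, f₀ z * Real.log (S.det⁻¹ * f₀ z) := by
    simp_rw [hf']
    rw [integral_sub_right_eq_self (fun w => S.det⁻¹ * f₀ (S⁻¹ *ᵥ w) *
      Real.log (S.det⁻¹ * f₀ (S⁻¹ *ᵥ w))) μ]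
    rw [integral_comp_mulVec S⁻¹ (by rw [hinvdet]; positivity)
      (fun z => S.det⁻¹ * f₀ z * Real.log (S.det⁻¹ * f₀ z)), hinvdet, abs_of_pos (by positivity),
      inv_inv, ← integral_const_mul]
    congr 1
    ext z
    field_simp
  set c := (2 * Real.pi) ^ (-(n : ℝ) / 2) with hc
  have hI1 : Integrable fun z => mvphi n 1 z * G z :=
    PP_integrable v hv0 Δ _ _ (phi_integrable n)
  have hI2 : Integrable fun z : Fin n → ℝ => ((z ⬝ᵥ z) * mvphi n 1 z) * G z :=
    PP_integrable v hv0 Δ _ _ (norm_phi_integrable n)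
  have hJ1 : ∫ z, mvphi n 1 z * G z = 1 := by
    have := PP_integral v hv0 Δ horth (fun r => c * Real.exp (-r / 2))
      (by simpa only [hc, ← phi_radial] using phi_integrable n) Finset.univ
    simp only [hc, ← phi_radial] at this
    rw [this, phi_integral]
  have hJ2 : ∫ z : Fin n → ℝ, ((z ⬝ᵥ z) * mvphi n 1 z) * G z = n := by
    have := PP_integral v hv0 Δ horth (fun r => r * (c * Real.exp (-r / 2)))
      (by simpa only [hc, ← phi_radial] using norm_phi_integrable n) Finset.univ
    simp only [hc, ← phi_radial] at this
    rw [this, norm_phi_integral]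
  have hI3 : Integrable fun z => mvphi n 1 z * (G z * Real.log (G z)) := by
    obtain ⟨C, hC⟩ := (isCompact_Icc (a := (0 : ℝ)) (b := 2 ^ (Finset.univ : Finset (Fin m)).card)).exists_bound_of_continuousOn
      Real.continuous_mul_log.continuousOn
    refine (phi_integrable n).mul_bdd (c := C) ?_ (Filter.Eventually.of_forall fun z => ?_)
    · exact (Real.continuous_mul_log.measurable.comp (PP_measurable v Δ _)).aestronglyMeasurable
    · exact hC _ ⟨PP_nonneg _ _ _ _, PP_le v hv0 Δ _ z⟩
  have hpt : ∀ z, f₀ z * Real.log (S.det⁻¹ * f₀ z)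
      = ((-Real.log S.det - ((n : ℝ) / 2) * Real.log (2 * π)) * (mvphi n 1 z * G z)
        + (-(1 / 2)) * (((z ⬝ᵥ z) * mvphi n 1 z) * G z))
        + mvphi n 1 z * (G z * Real.log (G z)) := by
    intro z
    have h1 := mul_log_mul (mvphi n 1 z) (G z)
    rw [log_phi] at h1
    have h2 : f₀ z * Real.log (S.det⁻¹ * f₀ z)
        = -Real.log S.det * f₀ z + f₀ z * Real.log (f₀ z) := by
      by_cases h0 : f₀ z = 0
      · simp [h0]
      · rw [Real.log_mul (by positivity) h0, Real.log_inv]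
        ring
    rw [h2, hf₀', h1]
    ring
  rw [hcv]
  simp_rw [hpt]
  rw [integral_add (by exact (hI1.const_mul _).add (hI2.const_mul _)) hI3,
    integral_add (hI1.const_mul _) (hI2.const_mul _), integral_const_mul, integral_const_mul,
    hJ1, hJ2, hlogdet]
  have : ∀ z, f₀ z * Real.log (2 ^ m * mvPhi m (1 - Δᵀ * Δ) (Δᵀ *ᵥ z))
      = mvphi n 1 z * (G z * Real.log (G z)) := by
    intro z; rw [hG, hf₀']; ring
  simp_rw [this]
  ring
end

section
/- If Y ~ LSN_n(μ, Σ, α) is multivariate log-skew-normal, then H_Y = H_{SN_n(μ,Σ,α)} + Σ_{i=1}^n E(Y*_i), where Y* ~ SN_n(μ, Σ, α). In particular, for α = 0, H_{LN_n(μ,Σ)} = H_{N_n(μ,Σ)} + Σ_{i=1}^n μ_i. -/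
open MeasureTheory Real Matrix

lemma aux_stdphi_eq : stdphi = ProbabilityTheory.gaussianPDFReal 0 1 := by
  ext x
  simp [stdphi, ProbabilityTheory.gaussianPDFReal]

lemma aux_stdphi_pos (x : ℝ) : 0 < stdphi x := by
  unfold stdphi; positivity

lemma aux_stdphi_int : Integrable stdphi := by
  rw [aux_stdphi_eq]; exact ProbabilityTheory.integrable_gaussianPDFReal 0 1

lemma aux_stdphi_integral : ∫ x, stdphi x = 1 := by
  rw [aux_stdphi_eq]; exact ProbabilityTheory.integral_gaussianPDFReal_eq_one 0 one_ne_zero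

lemma aux_stdphi_int_id : Integrable (fun x : ℝ => x * stdphi x) := by
  have h := (integrable_mul_exp_neg_mul_sq (b := 1/2) (by norm_num)).const_mul (√(2 * π))⁻¹
  refine h.congr (Filter.Eventually.of_forall fun x => ?_)
  simp only [stdphi]
  rw [show -(x^2)/2 = -(1/2) * x^2 by ring]; ring

lemma aux_stdphi_int_sq : Integrable (fun x : ℝ => x ^ 2 * stdphi x) := by
  have h := (integrable_rpow_mul_exp_neg_mul_sq (b := 1/2) (by norm_num)
    (s := 2) (by norm_num)).const_mul (√(2 * π))⁻¹
  refine h.congr (Filter.Eventually.of_forall fun x => ?_)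
  simp only [stdphi]
  rw [show -(x^2)/2 = -(1/2) * x^2 by ring, Real.rpow_two]; ring

lemma aux_stdphi_integral_sq : ∫ x : ℝ, x ^ 2 * stdphi x = 1 := by
  have h := ProbabilityTheory.variance_fun_id_gaussianReal (μ := 0) (v := 1)
  rw [ProbabilityTheory.variance_eq_integral measurable_id'.aemeasurable] at h
  simp only [ProbabilityTheory.integral_id_gaussianReal, sub_zero] at h
  rw [ProbabilityTheory.integral_gaussianReal_eq_integral_smul one_ne_zero, ← aux_stdphi_eq] at h
  simpa [mul_comm] using h

lemma aux_stdPhi_pos (x : ℝ) : 0 < stdPhi x := by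
  unfold stdPhi
  rw [setIntegral_pos_iff_support_of_nonneg_ae
    (Filter.Eventually.of_forall fun x => (aux_stdphi_pos x).le) aux_stdphi_int.integrableOn]
  have h : Function.support stdphi = Set.univ :=
    Set.eq_univ_of_forall fun y => (aux_stdphi_pos y).ne'
  rw [h]
  simp

lemma aux_stdPhi_le_one (x : ℝ) : stdPhi x ≤ 1 := by
  unfold stdPhi
  rw [← aux_stdphi_integral]
  exact setIntegral_le_integral aux_stdphi_int
    (Filter.Eventually.of_forall fun x => (aux_stdphi_pos x).le)

lemma aux_stdPhi_mono : Monotone stdPhi := by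
  intro x y h
  unfold stdPhi
  exact setIntegral_mono_set aux_stdphi_int.integrableOn
    (Filter.Eventually.of_forall fun x => (aux_stdphi_pos x).le)
    (Set.Iic_subset_Iic.2 h).eventuallyLE

lemma aux_prod {n : ℕ} (i : Fin n) (h : ℝ → ℝ) (hi : Integrable (fun x => h x * stdphi x)) :
    Integrable (fun w : Fin n → ℝ => h (w i) * ∏ j, stdphi (w j)) ∧
    ∫ w : Fin n → ℝ, h (w i) * ∏ j, stdphi (w j) = ∫ x, h x * stdphi x := by
  have e : (fun w : Fin n → ℝ => h (w i) * ∏ j, stdphi (w j)) =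
      fun w => ∏ j, (fun (j : Fin n) (x : ℝ) => (if j = i then h x else 1) * stdphi x) j (w j) := by
    ext w
    simp only [Finset.prod_mul_distrib]
    simp
  rw [e]
  constructor
  · apply Integrable.fintype_prod (f := fun (j : Fin n) (x : ℝ) => (if j = i then h x else 1) * stdphi x)
    intro j
    by_cases hj : j = i
    · simpa [hj] using hi
    · simpa [hj] using aux_stdphi_int
  · rw [integral_fintype_prod_volume_eq_prod (fun (j : Fin n) (x : ℝ) => (if j = i then h x else 1) * stdphi x), Finset.prod_eq_single i]
    · simp
    · intro j _ hj
      simp [hj, aux_stdphi_integral]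
    · simp

lemma aux_prod0 (n : ℕ) :
    Integrable (fun w : Fin n → ℝ => ∏ j, stdphi (w j)) ∧
    ∫ w : Fin n → ℝ, ∏ j, stdphi (w j) = 1 := by
  constructor
  · exact Integrable.fintype_prod (f := fun _ => stdphi) (fun _ => aux_stdphi_int)
  · rw [integral_fintype_prod_volume_eq_prod (fun _ => stdphi)]
    simp [aux_stdphi_integral]

lemma aux_lin {n : ℕ} (B : Matrix (Fin n) (Fin n) ℝ) (hB : B.det ≠ 0) (f : (Fin n → ℝ) → ℝ) :
    (Integrable f → Integrable (fun z => f (B *ᵥ z))) ∧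
    ∫ z, |B.det| * f (B *ᵥ z) = ∫ w, f w := by
  have hm := Real.map_matrix_volume_pi_eq_smul_volume_pi hB
  have hu : IsUnit B := (Matrix.isUnit_iff_isUnit_det B).2 (isUnit_iff_ne_zero.2 hB)
  have hemb : MeasurableEmbedding (toLin' B) := by
    have : Continuous (toLin' B) := LinearMap.continuous_of_finiteDimensional _
    exact this.measurableEmbedding (Matrix.mulVec_injective_of_isUnit hu)
  constructor
  · intro hf
    have : Integrable f (Measure.map (toLin' B) volume) := by
      rw [hm]; exact hf.smul_measure ENNReal.ofReal_ne_top
    exact (hemb.integrable_map_iff.1 this)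
  · have h := hemb.integral_map (μ := volume) f
    rw [hm, integral_smul_measure, ENNReal.toReal_ofReal (abs_nonneg _)] at h
    rw [integral_const_mul]
    simp only [Matrix.toLin'_apply] at h
    rw [← h, smul_eq_mul, ← mul_assoc, ← abs_mul, mul_inv_cancel₀ hB]; simp

open scoped MatrixOrder in
lemma aux_decomp {n : ℕ} (V : Matrix (Fin n) (Fin n) ℝ) (hV : V.PosDef) :
    ∃ B : Matrix (Fin n) (Fin n) ℝ, B.det ≠ 0 ∧
      (∀ z, z ⬝ᵥ (V⁻¹ *ᵥ z) = ∑ i, (B *ᵥ z) i ^ 2) ∧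
      (∀ z, mvphi n V z = |B.det| * ∏ j, stdphi ((B *ᵥ z) j)) := by
  obtain ⟨B, hB⟩ := CStarAlgebra.nonneg_iff_eq_star_mul_self.mp hV.inv.posSemidef.nonneg
  have hd : B.det * B.det = V.det⁻¹ := by
    have := congrArg Matrix.det hB
    rw [Matrix.det_nonsing_inv, Ring.inverse_eq_inv', Matrix.det_mul, Matrix.star_eq_conjTranspose,
      Matrix.det_conjTranspose] at this
    simpa using this.symm
  have hVd := hV.det_pos
  have hq : ∀ z, z ⬝ᵥ (V⁻¹ *ᵥ z) = ∑ i, (B *ᵥ z) i ^ 2 := by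
    intro z
    rw [hB, ← Matrix.mulVec_mulVec, Matrix.dotProduct_mulVec, Matrix.star_eq_conjTranspose,
      Matrix.vecMul_conjTranspose]
    simp [dotProduct, sq]
  refine ⟨B, ?_, hq, ?_⟩
  · intro h0
    rw [h0] at hd
    have : 0 < V.det⁻¹ := by positivity
    simp [← hd] at this
  · intro z
    have habs : |B.det| = (√V.det)⁻¹ := by
      rw [← Real.sqrt_inv, ← hd, Real.sqrt_mul_self_eq_abs]
    unfold mvphi stdphi
    rw [hq, habs, Finset.prod_mul_distrib, ← Real.exp_sum]
    have : (2 * π) ^ (-(n : ℝ) / 2) = ∏ _j : Fin n, (√(2 * π))⁻¹ := by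
      rw [Finset.prod_const, Finset.card_univ, Fintype.card_fin, Real.sqrt_eq_rpow, ← Real.rpow_neg
        (by positivity), ← Real.rpow_natCast, ← Real.rpow_mul (by positivity)]
      congr 1; ring
    rw [this, ← Finset.sum_div, Finset.sum_neg_distrib]; ring

lemma aux_mvphi {n : ℕ} (V : Matrix (Fin n) (Fin n) ℝ) (hV : V.PosDef) :
    Integrable (mvphi n V) ∧ ∫ z, mvphi n V z = 1 ∧
    (∀ i, Integrable (fun z => z i * mvphi n V z)) ∧
    (∀ i, ∫ z, z i * mvphi n V z = 0) ∧
    Integrable (fun z => (z ⬝ᵥ (V⁻¹ *ᵥ z)) * mvphi n V z) ∧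
    ∫ z, (z ⬝ᵥ (V⁻¹ *ᵥ z)) * mvphi n V z = n := by
  obtain ⟨B, hB, hq, hphi⟩ := aux_decomp V hV
  have hBB : B⁻¹ * B = 1 := Matrix.nonsing_inv_mul B (isUnit_iff_ne_zero.2 hB)
  refine ⟨?_, ?_, fun i => ?_, fun i => ?_, ?_, ?_⟩
  · rw [funext hphi]
    exact ((aux_lin B hB (fun w => ∏ j, stdphi (w j))).1 (aux_prod0 n).1).const_mul _
  · rw [funext hphi]
    exact ((aux_lin B hB (fun w => ∏ j, stdphi (w j))).2).trans (aux_prod0 n).2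
  · have h1 : Integrable (fun w : Fin n → ℝ => (B⁻¹ *ᵥ w) i * ∏ j, stdphi (w j)) := by
      simp only [mulVec, dotProduct, Finset.sum_mul]
      refine integrable_finsetSum _ fun k _ => ?_
      simp only [mul_assoc]
      exact ((aux_prod k (fun x => x) aux_stdphi_int_id).1).const_mul _
    refine (((aux_lin B hB _).1 h1).const_mul |B.det|).congr (Filter.Eventually.of_forall fun z => ?_)
    simp only [Matrix.mulVec_mulVec, hBB, Matrix.one_mulVec, hphi]
    ring
  · have hneg : ∀ z, mvphi n V (-z) = mvphi n V z := by
      intro z; simp [mvphi, Matrix.mulVec_neg]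
    have h := integral_neg_eq_self (fun z : Fin n → ℝ => z i * mvphi n V z) volume
    simp only [hneg, Pi.neg_apply, neg_mul, integral_neg] at h
    linarith
  · have h1 : Integrable (fun w : Fin n → ℝ => (∑ k, w k ^ 2) * ∏ j, stdphi (w j)) := by
      simp only [Finset.sum_mul]
      exact integrable_finsetSum _ fun k _ => (aux_prod k (fun x => x ^ 2) aux_stdphi_int_sq).1
    refine (((aux_lin B hB _).1 h1).const_mul |B.det|).congr (Filter.Eventually.of_forall fun z => ?_)
    simp only [hq, hphi]
    ring
  · have h2 : ∫ w : Fin n → ℝ, (∑ k, w k ^ 2) * ∏ j, stdphi (w j) = n := by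
      simp only [Finset.sum_mul]
      rw [integral_finsetSum _ fun k _ => (aux_prod k (fun x => x ^ 2) aux_stdphi_int_sq).1]
      simp [(aux_prod _ (fun x => x ^ 2) aux_stdphi_int_sq).2, aux_stdphi_integral_sq]
    rw [← h2, ← (aux_lin B hB (fun w : Fin n → ℝ => (∑ k, w k ^ 2) * ∏ j, stdphi (w j))).2]
    congr 1; ext z
    rw [hq, hphi]; ring

lemma aux_cov {n : ℕ} (F : (Fin n → ℝ) → ℝ) (hF : ∀ u, ¬ (∀ i, 0 < u i) → F u = 0) :
    ∫ u, F u = ∫ y : Fin n → ℝ, Real.exp (∑ i, y i) * F (fun i => Real.exp (y i)) := by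
  let f : (Fin n → ℝ) → (Fin n → ℝ) := fun y i => Real.exp (y i)
  let f' : (Fin n → ℝ) → ((Fin n → ℝ) →L[ℝ] (Fin n → ℝ)) := fun y =>
    ContinuousLinearMap.pi fun i =>
      (ContinuousLinearMap.toSpanSingleton ℝ (Real.exp (y i))).comp (ContinuousLinearMap.proj i)
  have hder : ∀ y ∈ (Set.univ : Set (Fin n → ℝ)), HasFDerivWithinAt f (f' y) Set.univ y := by
    intro y _
    refine HasFDerivAt.hasFDerivWithinAt (hasFDerivAt_pi.2 fun i => ?_)
    have h1 : HasFDerivAt (fun z : Fin n → ℝ => z i) (ContinuousLinearMap.proj (R := ℝ) i) y :=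
      hasFDerivAt_apply i y
    exact HasFDerivAt.comp (g := Real.exp) y (Real.hasDerivAt_exp (y i)).hasFDerivAt h1
  have hinj : Set.InjOn f Set.univ := by
    intro a _ b _ h
    ext i
    exact Real.exp_injective (congrFun h i)
  have h := integral_image_eq_integral_abs_det_fderiv_smul volume MeasurableSet.univ hder hinj F
  have himg : f '' Set.univ = {u | ∀ i, 0 < u i} := by
    ext u
    constructor
    · rintro ⟨y, _, rfl⟩ i; exact Real.exp_pos _
    · intro hu
      exact ⟨fun i => Real.log (u i), trivial, funext fun i => Real.exp_log (hu i)⟩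
  rw [himg, setIntegral_eq_integral_of_forall_compl_eq_zero (s := {u : Fin n → ℝ | ∀ i, 0 < u i})
    (fun u hu => hF u hu), Measure.restrict_univ] at h
  rw [h]
  congr 1; ext y
  have : (f' y).det = Real.exp (∑ i, y i) := by
    simp only [f']
    rw [ContinuousLinearMap.det_pi, Real.exp_sum]
    simp [ContinuousLinearMap.det_toSpanSingleton]
  rw [this, abs_of_pos (Real.exp_pos _), smul_eq_mul]

lemma aux_mvphi_pos {n : ℕ} (V : Matrix (Fin n) (Fin n) ℝ) (hV : V.PosDef) (z : Fin n → ℝ) :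
    0 < mvphi n V z := by
  have := hV.det_pos
  unfold mvphi; positivity

lemma aux_log_mvphi {n : ℕ} (V : Matrix (Fin n) (Fin n) ℝ) (hV : V.PosDef) (z : Fin n → ℝ) :
    Real.log (mvphi n V z) =
      (-((n : ℝ) / 2) * Real.log (2 * π) - (1 / 2) * Real.log V.det) - (z ⬝ᵥ (V⁻¹ *ᵥ z)) / 2 := by
  have hd := hV.det_pos
  have h1 : (0 : ℝ) < (2 * π) ^ (-(n : ℝ) / 2) := by positivity
  have h2 : 0 < (√V.det)⁻¹ := by positivity
  unfold mvphi
  rw [Real.log_mul (by positivity) (by positivity), Real.log_mul h1.ne' h2.ne', Real.log_exp,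
    Real.log_rpow (by positivity), Real.log_inv, Real.log_sqrt hd.le]
  ring

/-- If `Y ~ LSN_n(μ, Σ, α)` is multivariate log-skew-normal (Marchenko–Genton), then
`H_Y = H_{SN_n(μ,Σ,α)} + Σᵢ E(Y*ᵢ)` with `Y* ~ SN_n(μ, Σ, α)`; and in the case `α = 0`,
`H_{LN_n(μ,Σ)} = H_{N_n(μ,Σ)} + Σᵢ μᵢ`. -/
theorem entropy_multivariate_log_skew_normal (n : ℕ) (μ : Fin n → ℝ)
    (Sig : Matrix (Fin n) (Fin n) ℝ) (hSig : Sig.PosDef) (α : Fin n → ℝ)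
    (fSN fY gLN : (Fin n → ℝ) → ℝ)
    (hfSN : ∀ y, fSN y = 2 * mvphi n Sig (y - μ) *
      stdPhi (∑ i, α i * (Real.sqrt (Sig i i))⁻¹ * (y i - μ i)))
    (hfY : ∀ u : Fin n → ℝ, (∀ i, 0 < u i) →
      fY u = 2 * (∏ i, u i)⁻¹ * mvphi n Sig ((fun i => Real.log (u i)) - μ) *
        stdPhi (∑ i, α i * (Real.sqrt (Sig i i))⁻¹ * (Real.log (u i) - μ i)))
    (hfY0 : ∀ u : Fin n → ℝ, ¬ (∀ i, 0 < u i) → fY u = 0)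
    (hgLN : ∀ u : Fin n → ℝ, (∀ i, 0 < u i) →
      gLN u = (∏ i, u i)⁻¹ * mvphi n Sig ((fun i => Real.log (u i)) - μ))
    (hgLN0 : ∀ u : Fin n → ℝ, ¬ (∀ i, 0 < u i) → gLN u = 0) :
    (-∫ u, fY u * Real.log (fY u) =
        (-∫ y, fSN y * Real.log (fSN y)) + ∑ i, (∫ y, y i * fSN y)) ∧
    (-∫ u, gLN u * Real.log (gLN u) =
        ((1 / 2) * Real.log Sig.det + ((n : ℝ) / 2) * (1 + Real.log (2 * π))) + ∑ i, μ i) := by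
  obtain ⟨J0, E0, J1, E1, J2, E2⟩ := aux_mvphi Sig hSig
  have hpos := aux_mvphi_pos Sig hSig
  have hlog := aux_log_mvphi Sig hSig
  have hPm : Measurable fun y : Fin n → ℝ =>
      stdPhi (∑ i, α i * (Real.sqrt (Sig i i))⁻¹ * (y i - μ i)) :=
    aux_stdPhi_mono.measurable.comp (by fun_prop)
  set c : ℝ := -((n : ℝ) / 2) * Real.log (2 * π) - (1 / 2) * Real.log Sig.det with hc
  constructor
  · set P : (Fin n → ℝ) → ℝ := fun y =>
      stdPhi (∑ i, α i * (Real.sqrt (Sig i i))⁻¹ * (y i - μ i)) with hP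
    have hP0 : ∀ y, 0 < P y := fun y => aux_stdPhi_pos _
    have hP1 : ∀ y, P y ≤ 1 := fun y => aux_stdPhi_le_one _
    have hS : ∀ y, fSN y = 2 * mvphi n Sig (y - μ) * P y := hfSN
    have hSpos : ∀ y, 0 < fSN y := fun y => by
      rw [hS]; have := hpos (y - μ); have := hP0 y; positivity
    have hbd : ∀ g : (Fin n → ℝ) → ℝ, Integrable g → Integrable (fun y => g (y - μ) * P y) := by
      intro g hg
      refine (hg.comp_sub_right μ).mul_bdd (c := 1) hPm.aestronglyMeasurable
        (Filter.Eventually.of_forall fun y => ?_)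
      rw [Real.norm_eq_abs, abs_of_pos (hP0 y)]; exact hP1 y
    have hbdlog : Integrable (fun y => mvphi n Sig (y - μ) * (P y * Real.log (P y))) := by
      refine (J0.comp_sub_right μ).mul_bdd (c := 1)
        (hPm.mul (Real.measurable_log.comp hPm)).aestronglyMeasurable
        (Filter.Eventually.of_forall fun y => ?_)
      have h1 := Real.negMulLog_le_one_sub_self (hP0 y).le
      have h2 := Real.negMulLog_nonneg (hP0 y).le (hP1 y)
      rw [Real.negMulLog] at h1 h2
      have := hP0 y
      rw [Real.norm_eq_abs, abs_le]
      constructor <;> linarith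
    have I1 : ∀ i, Integrable (fun y : Fin n → ℝ => y i * fSN y) := by
      intro i
      refine ((hbd _ (J1 i)).add ((hbd _ J0).const_mul (μ i)) |>.const_mul 2).congr
        (Filter.Eventually.of_forall fun y => ?_)
      simp only [hS, Pi.add_apply, Pi.sub_apply]; ring
    have I2 : Integrable (fun y => fSN y * Real.log (fSN y)) := by
      refine ((((hbd _ J0).const_mul (2 * (Real.log 2 + c))).sub (hbd _ J2)).add
        (hbdlog.const_mul 2)).congr (Filter.Eventually.of_forall fun y => ?_)
      have e : Real.log (fSN y) = Real.log 2 + (c - ((y - μ) ⬝ᵥ (Sig⁻¹ *ᵥ (y - μ))) / 2)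
          + Real.log (P y) := by
        rw [hS, Real.log_mul (mul_pos two_pos (hpos _)).ne' (hP0 y).ne',
          Real.log_mul two_ne_zero (hpos _).ne', hlog]
      simp only [e, Pi.add_apply, Pi.sub_apply]
      rw [hS]; ring
    have hY : ∀ y : Fin n → ℝ, fY (fun i => Real.exp (y i)) = Real.exp (-∑ i, y i) * fSN y := by
      intro y
      rw [hfY _ fun i => Real.exp_pos _, hS, Real.exp_neg, Real.exp_sum]
      simp only [Real.log_exp, hP]; ring
    rw [aux_cov (fun u => fY u * Real.log (fY u)) (fun u hu => by simp [hfY0 u hu])]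
    have e : ∀ y : Fin n → ℝ, Real.exp (∑ i, y i) *
        (fY (fun i => Real.exp (y i)) * Real.log (fY (fun i => Real.exp (y i)))) =
        fSN y * Real.log (fSN y) - ∑ i, y i * fSN y := by
      intro y
      rw [hY, Real.log_mul (Real.exp_pos _).ne' (hSpos y).ne', Real.log_exp, Real.exp_neg,
        ← Finset.sum_mul]
      have := (Real.exp_pos (∑ i, y i)).ne'
      field_simp
      ring
    simp only [e]
    rw [integral_sub I2 (integrable_finsetSum _ fun i _ => I1 i),
      integral_finsetSum _ fun i _ => I1 i]
    ring
  · rw [aux_cov (fun u => gLN u * Real.log (gLN u)) (fun u hu => by simp [hgLN0 u hu])]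
    have hY : ∀ y : Fin n → ℝ,
        gLN (fun i => Real.exp (y i)) = Real.exp (-∑ i, y i) * mvphi n Sig (y - μ) := by
      intro y
      rw [hgLN _ fun i => Real.exp_pos _, Real.exp_neg, Real.exp_sum]
      simp only [Real.log_exp]
    have e : ∀ y : Fin n → ℝ, Real.exp (∑ i, y i) *
        (gLN (fun i => Real.exp (y i)) * Real.log (gLN (fun i => Real.exp (y i)))) =
        (fun z : Fin n → ℝ => (c - ∑ i, μ i) * mvphi n Sig z
          - (1 / 2) * ((z ⬝ᵥ (Sig⁻¹ *ᵥ z)) * mvphi n Sig z)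
          - ∑ i, z i * mvphi n Sig z) (y - μ) := by
      intro y
      rw [hY, Real.log_mul (Real.exp_pos _).ne' (hpos _).ne', Real.log_exp, hlog, Real.exp_neg]
      simp only [← Finset.sum_mul, Pi.sub_apply, Finset.sum_sub_distrib]
      have := (Real.exp_pos (∑ i, y i)).ne'
      field_simp
      ring
    simp only [e]
    have K : Integrable (fun z : Fin n → ℝ => (c - ∑ i, μ i) * mvphi n Sig z
          - (1 / 2) * ((z ⬝ᵥ (Sig⁻¹ *ᵥ z)) * mvphi n Sig z)) :=
      (J0.const_mul _).sub (J2.const_mul _)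
    rw [integral_sub_right_eq_self (fun z : Fin n → ℝ => (c - ∑ i, μ i) * mvphi n Sig z
          - (1 / 2) * ((z ⬝ᵥ (Sig⁻¹ *ᵥ z)) * mvphi n Sig z)
          - ∑ i, z i * mvphi n Sig z) μ,
      integral_sub K (integrable_finsetSum _ fun i _ => J1 i),
      integral_sub (J0.const_mul _) (J2.const_mul _), integral_const_mul, integral_const_mul,
      integral_finsetSum _ fun i _ => J1 i, E0, E2]
    simp only [E1, Finset.sum_const_zero, hc]
    ring
end

section
/- Let X ~ CFUSN_{n,m}(Δ) with partition X = (X₁, X₂), Δ = (Δ₁; Δ₂), and let Z = exp(X) ~ LCFUSN_{n,m}(Δ) with corresponding partition (Z₁, Z₂). Then the mutual information is I_{Z₁,Z₂} = E[ln( Φ_m(Δ'X | I_m − Δ'Δ) / (2^m Φ_m(Δ₁'X₁ | I_m − Δ₁'Δ₁) Φ_m(Δ₂'X₂ | I_m − Δ₂'Δ₂)) )]. -/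
open MeasureTheory Real Matrix

lemma mvphi_one_eq (k : ℕ) (z : Fin k → ℝ) :
    mvphi k 1 z = (2 * Real.pi) ^ (-(k : ℝ) / 2) * Real.exp (-(1/2) * ∑ i, z i ^ 2) := by
  simp only [mvphi, det_one, Real.sqrt_one, inv_one, mul_one, one_mulVec, dotProduct]
  congr 2
  simp only [← sq]
  ring

lemma integrable_exp_neg_sum (k : ℕ) {b : ℝ} (hb : 0 < b) :
    Integrable (fun z : Fin k → ℝ => Real.exp (-b * ∑ i, z i ^ 2)) := by
  simp_rw [Finset.mul_sum, Real.exp_sum]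
  exact Integrable.fintype_prod (f := fun _ (v : ℝ) ↦ Real.exp (-b * v ^ 2))
    (fun i ↦ integrable_exp_neg_mul_sq hb)

lemma mvphi_nonneg (k : ℕ) (V : Matrix (Fin k) (Fin k) ℝ) (z) : 0 ≤ mvphi k V z := by
  unfold mvphi; positivity

lemma mvphi_pos (k : ℕ) {V : Matrix (Fin k) (Fin k) ℝ} (hV : V.PosDef) (z) : 0 < mvphi k V z := by
  have := hV.det_pos
  unfold mvphi; positivity

lemma continuous_mvphi (k : ℕ) (V : Matrix (Fin k) (Fin k) ℝ) : Continuous (mvphi k V) := by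
  unfold mvphi
  fun_prop

/-- the Gaussian measure with density `mvphi`. -/
noncomputable def gV (k : ℕ) (V : Matrix (Fin k) (Fin k) ℝ) : Measure (Fin k → ℝ) :=
  volume.withDensity (fun z => ENNReal.ofReal (mvphi k V z))

lemma measurable_ofReal_mvphi (k : ℕ) (V : Matrix (Fin k) (Fin k) ℝ) :
    Measurable (fun z => ENNReal.ofReal (mvphi k V z)) :=
  (continuous_mvphi k V).measurable.ennreal_ofReal

lemma integrable_mvphi_one (k : ℕ) : Integrable (mvphi k 1) := by
  have : mvphi k 1 = fun z => (2 * Real.pi) ^ (-(k : ℝ) / 2) * Real.exp (-(1/2) * ∑ i, z i ^ 2) :=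
    funext (mvphi_one_eq k)
  rw [this]
  exact (integrable_exp_neg_sum k (by norm_num)).const_mul _

instance finite_gV_one (k : ℕ) : IsFiniteMeasure (gV k 1) :=
  isFiniteMeasure_withDensity_ofReal (integrable_mvphi_one k).2

lemma integral_gV (k : ℕ) (V : Matrix (Fin k) (Fin k) ℝ) (g : (Fin k → ℝ) → ℂ) :
    ∫ z, g z ∂(gV k V) = ∫ z, (mvphi k V z : ℂ) * g z := by
  rw [gV, integral_withDensity_eq_integral_toReal_smul (measurable_ofReal_mvphi k V)
    (by filter_upwards with x using ENNReal.ofReal_lt_top)]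
  refine integral_congr_ae (Filter.Eventually.of_forall fun z => ?_)
  simp [ENNReal.toReal_ofReal (mvphi_nonneg k V z)]

lemma cf_gV_one (k : ℕ) (t : Fin k → ℝ) :
    ∫ z, Complex.exp (((t ⬝ᵥ z : ℝ) : ℂ) * Complex.I) ∂(gV k 1)
      = Complex.exp (((-(t ⬝ᵥ t) / 2 : ℝ) : ℂ)) := by
  rw [integral_gV]
  have h := GaussianFourier.integral_cexp_neg_mul_sum_add (ι := Fin k) (b := (1/2 : ℂ)) (by norm_num)
    (fun i => (t i : ℂ) * Complex.I)
  have e : ∀ z : Fin k → ℝ, (mvphi k 1 z : ℂ) * Complex.exp (((t ⬝ᵥ z : ℝ) : ℂ) * Complex.I)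
      = (((2 * Real.pi) ^ (-(k : ℝ) / 2) : ℝ) : ℂ) *
        Complex.exp (-(1/2) * ∑ i, (z i : ℂ) ^ 2 + ∑ i, (t i : ℂ) * Complex.I * z i) := by
    intro z
    rw [mvphi_one_eq, Complex.exp_add]
    push_cast [dotProduct]
    rw [mul_assoc, Finset.sum_mul]
    congr 4
    funext i
    ring
  simp_rw [e]
  rw [integral_const_mul, h, ← mul_assoc]
  have h1 : ((Real.pi : ℂ) / (1/2)) ^ ((Fintype.card (Fin k) : ℂ) / 2)
      = (((2 * Real.pi) ^ ((k : ℝ) / 2) : ℝ) : ℂ) := by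
    rw [Complex.ofReal_cpow (by positivity)]
    push_cast
    rw [Fintype.card_fin]
    congr 1
    ring
  rw [h1, ← Complex.ofReal_mul, ← Real.rpow_add (by positivity)]
  have : -(k : ℝ) / 2 + k / 2 = 0 := by ring
  rw [this, Real.rpow_zero, Complex.ofReal_one, one_mul]
  congr 1
  push_cast [dotProduct, mul_pow, Complex.I_sq]
  simp only [← sq]
  rw [← Finset.sum_mul]
  ring

instance prob_gV_one (k : ℕ) : IsProbabilityMeasure (gV k 1) := by
  have h := cf_gV_one k 0
  simp at h
  constructor
  have h2 : (gV k 1).real Set.univ = 1 := by exact_mod_cast h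
  have := ofReal_measureReal (μ := gV k 1) (s := Set.univ)
  rw [← this, h2, ENNReal.ofReal_one]

open scoped MatrixOrder in
lemma exists_factor (k : ℕ) {V : Matrix (Fin k) (Fin k) ℝ} (hV : V.PosDef) :
    ∃ A : Matrix (Fin k) (Fin k) ℝ, V = A * Aᵀ ∧ A.det ≠ 0 := by
  obtain ⟨B, hB⟩ := CStarAlgebra.nonneg_iff_eq_star_mul_self.mp hV.posSemidef.nonneg
  refine ⟨Bᵀ, ?_, ?_⟩
  · rw [hB]; simp [star_eq_conjTranspose]
  · intro h
    have := hV.det_pos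
    rw [hB, det_mul] at this
    rw [det_transpose] at h
    simp [h] at this

lemma gV_eq_map (k : ℕ) {V A : Matrix (Fin k) (Fin k) ℝ} (h : V = A * Aᵀ) (hA : A.det ≠ 0) :
    gV k V = (gV k 1).map (fun z => A *ᵥ z) := by
  have hm : Measurable (fun z : Fin k → ℝ => A *ᵥ z) := by fun_prop
  have hu : IsUnit A.det := hA.isUnit
  ext s hs
  rw [Measure.map_apply hm hs, gV, gV, withDensity_apply _ hs, withDensity_apply _ (hm hs)]
  have key : ∀ z, ENNReal.ofReal (mvphi k 1 z)
      = ENNReal.ofReal |A.det| * ENNReal.ofReal (mvphi k V (A *ᵥ z)) := by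
    intro z
    rw [← ENNReal.ofReal_mul (abs_nonneg _)]
    congr 1
    unfold mvphi
    have h1 : V.det = A.det ^ 2 := by rw [h, det_mul, det_transpose]; ring
    have h2 : (A *ᵥ z) ⬝ᵥ (V⁻¹ *ᵥ (A *ᵥ z)) = z ⬝ᵥ z := by
      rw [h, Matrix.mul_inv_rev, mulVec_mulVec, mul_assoc, Matrix.nonsing_inv_mul _ hu, mul_one,
        dotProduct_comm, ← dotProduct_transpose_mulVec, mulVec_mulVec, ← transpose_nonsing_inv,
        ← transpose_mul, Matrix.nonsing_inv_mul _ hu, transpose_one, one_mulVec]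
    rw [h1, h2, Real.sqrt_sq_eq_abs]
    have : |A.det| ≠ 0 := abs_ne_zero.mpr hA
    simp
    field_simp
  simp_rw [key]
  rw [lintegral_const_mul (μ := volume.restrict ((fun z => A *ᵥ z) ⁻¹' s)) (ENNReal.ofReal |A.det|)
    (f := fun z => ENNReal.ofReal (mvphi k V (A *ᵥ z))) ((measurable_ofReal_mvphi k V).comp hm)]
  have h3 := setLIntegral_map (μ := volume) hs (measurable_ofReal_mvphi k V) hm
  have h4 : Measure.map (fun z : Fin k → ℝ => A *ᵥ z) volume
    = ENNReal.ofReal |A.det⁻¹| • volume := Real.map_matrix_volume_pi_eq_smul_volume_pi hA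
  rw [← h3, h4, Measure.restrict_smul, lintegral_smul_measure, smul_eq_mul, ← mul_assoc,
    ← ENNReal.ofReal_mul (abs_nonneg _), ← abs_mul, mul_inv_cancel₀ hA]
  simp

lemma prob_gV (k : ℕ) {V : Matrix (Fin k) (Fin k) ℝ} (hV : V.PosDef) :
    IsProbabilityMeasure (gV k V) := by
  obtain ⟨A, h, hA⟩ := exists_factor k hV
  rw [gV_eq_map k h hA]
  exact Measure.isProbabilityMeasure_map (by fun_prop)

lemma cf_gV (k : ℕ) {V : Matrix (Fin k) (Fin k) ℝ} (hV : V.PosDef) (t : Fin k → ℝ) :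
    ∫ z, Complex.exp (((t ⬝ᵥ z : ℝ) : ℂ) * Complex.I) ∂(gV k V)
      = Complex.exp (((-(t ⬝ᵥ (V *ᵥ t)) / 2 : ℝ) : ℂ)) := by
  obtain ⟨A, h, hA⟩ := exists_factor k hV
  rw [gV_eq_map k h hA, integral_map (by fun_prop) (by fun_prop)]
  have e : ∀ z, t ⬝ᵥ (A *ᵥ z) = (Aᵀ *ᵥ t) ⬝ᵥ z := fun z => by
    rw [dotProduct_mulVec, mulVec_transpose]
  simp_rw [e]
  rw [cf_gV_one, ← e, mulVec_mulVec, h]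

lemma conv_gV (n k : ℕ) {V : Matrix (Fin k) (Fin k) ℝ} (hV : V.PosDef)
    (B : Matrix (Fin n) (Fin k) ℝ) (hVB : (V + Bᵀ * B).PosDef) :
    ((gV n 1).prod (gV k V)).map (fun p => p.2 - Bᵀ *ᵥ p.1) = gV k (V + Bᵀ * B) := by
  have := prob_gV k hV
  have := prob_gV k hVB
  have hm : Measurable (fun p : (Fin n → ℝ) × (Fin k → ℝ) => p.2 - Bᵀ *ᵥ p.1) := by fun_prop
  have := Measure.isProbabilityMeasure_map (μ := (gV n 1).prod (gV k V)) hm.aemeasurable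
  apply Measure.ext_of_charFunDual
  funext L
  obtain ⟨t, ht⟩ : ∃ t : Fin k → ℝ, ∀ z, L z = t ⬝ᵥ z := by
    refine ⟨fun i => L (Pi.single i 1), fun z => ?_⟩
    conv_lhs => rw [pi_eq_sum_univ' z]
    simp [dotProduct, mul_comm]
  rw [charFunDual_apply, charFunDual_apply]
  simp_rw [ht]
  rw [cf_gV k hVB, integral_map hm.aemeasurable (by fun_prop)]
  have e : ∀ p : (Fin n → ℝ) × (Fin k → ℝ),
      Complex.exp (((t ⬝ᵥ (p.2 - Bᵀ *ᵥ p.1) : ℝ) : ℂ) * Complex.I)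
      = Complex.exp ((((-(B *ᵥ t)) ⬝ᵥ p.1 : ℝ) : ℂ) * Complex.I) *
        Complex.exp (((t ⬝ᵥ p.2 : ℝ) : ℂ) * Complex.I) := by
    intro p
    rw [← Complex.exp_add, dotProduct_sub, dotProduct_mulVec, vecMul_transpose, neg_dotProduct]
    congr 1
    push_cast
    ring
  simp_rw [e]
  rw [integral_prod_mul (fun w : Fin n → ℝ => Complex.exp ((((-(B *ᵥ t)) ⬝ᵥ w : ℝ) : ℂ) * Complex.I))
    (fun w : Fin k → ℝ => Complex.exp (((t ⬝ᵥ w : ℝ) : ℂ) * Complex.I)), cf_gV_one, cf_gV k hV,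
    ← Complex.exp_add, ← Complex.ofReal_add]
  congr 2
  rw [add_mulVec, dotProduct_add, ← mulVec_mulVec, dotProduct_mulVec t Bᵀ, vecMul_transpose]
  simp
  ring

lemma integrable_mvphi (k : ℕ) {V : Matrix (Fin k) (Fin k) ℝ} (hV : V.PosDef) :
    Integrable (mvphi k V) := by
  refine ⟨(continuous_mvphi k V).aestronglyMeasurable, ?_⟩
  have := prob_gV k hV
  have h1 := this.measure_univ
  rw [gV, withDensity_apply _ MeasurableSet.univ, Measure.restrict_univ] at h1
  rw [hasFiniteIntegral_iff_ofReal (Filter.Eventually.of_forall (mvphi_nonneg k V)), h1]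
  exact ENNReal.one_lt_top

lemma ofReal_mvPhi (k : ℕ) {V : Matrix (Fin k) (Fin k) ℝ} (hV : V.PosDef) (x : Fin k → ℝ) :
    ENNReal.ofReal (mvPhi k V x) = gV k V (Set.Iic x) := by
  rw [mvPhi, gV, withDensity_apply _ measurableSet_Iic,
    ofReal_integral_eq_lintegral_ofReal (integrable_mvphi k hV).integrableOn
      (Filter.Eventually.of_forall (mvphi_nonneg k V))]

lemma mvPhi_nonneg (k : ℕ) (V : Matrix (Fin k) (Fin k) ℝ) (x : Fin k → ℝ) : 0 ≤ mvPhi k V x :=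
  integral_nonneg (mvphi_nonneg k V)

lemma mvPhi_le_one (k : ℕ) {V : Matrix (Fin k) (Fin k) ℝ} (hV : V.PosDef) (x : Fin k → ℝ) :
    mvPhi k V x ≤ 1 := by
  have := prob_gV k hV
  have h : ENNReal.ofReal (mvPhi k V x) ≤ 1 := by rw [ofReal_mvPhi k hV]; exact prob_le_one
  exact ENNReal.ofReal_le_one.mp h

lemma mvPhi_pos (k : ℕ) {V : Matrix (Fin k) (Fin k) ℝ} (hV : V.PosDef) (x : Fin k → ℝ) :
    0 < mvPhi k V x := by
  rw [mvPhi, setIntegral_pos_iff_support_of_nonneg_ae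
    (Filter.Eventually.of_forall (mvphi_nonneg k V)) (integrable_mvphi k hV).integrableOn]
  have : Function.support (mvphi k V) = Set.univ := by
    ext z; simp [(mvphi_pos k hV z).ne']
  rw [this, Set.univ_inter]
  refine Measure.measure_pos_of_mem_nhds volume (x := fun i => x i - 1) ?_
  exact pi_Iic_mem_nhds (fun i => by linarith)

lemma measurable_mvPhi (k : ℕ) {V : Matrix (Fin k) (Fin k) ℝ} (hV : V.PosDef) :
    Measurable (mvPhi k V) := by
  have := prob_gV k hV
  have e : mvPhi k V = fun x => (gV k V (Prod.mk x ⁻¹' {p : (Fin k → ℝ) × (Fin k → ℝ) | p.2 ≤ p.1})).toReal := by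
    funext x
    rw [show (Prod.mk x ⁻¹' {p : (Fin k → ℝ) × (Fin k → ℝ) | p.2 ≤ p.1}) = Set.Iic x from rfl,
      ← ofReal_mvPhi k hV, ENNReal.toReal_ofReal (mvPhi_nonneg k V x)]
  rw [e]
  exact (measurable_measure_prodMk_left
    (isClosed_le continuous_snd continuous_fst).measurableSet).ennreal_toReal

lemma marginal_mvPhi (n k : ℕ) {V : Matrix (Fin k) (Fin k) ℝ} (hV : V.PosDef)
    (B : Matrix (Fin n) (Fin k) ℝ) (hVB : (V + Bᵀ * B).PosDef) (x : Fin k → ℝ) :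
    ∫⁻ w, ENNReal.ofReal (mvphi n 1 w) * ENNReal.ofReal (mvPhi k V (x + Bᵀ *ᵥ w))
      = ENNReal.ofReal (mvPhi k (V + Bᵀ * B) x) := by
  have := prob_gV k hV
  have hm : Measurable (fun p : (Fin n → ℝ) × (Fin k → ℝ) => p.2 - Bᵀ *ᵥ p.1) := by fun_prop
  rw [ofReal_mvPhi k hVB, ← conv_gV n k hV B hVB, Measure.map_apply hm measurableSet_Iic,
    Measure.prod_apply (hm measurableSet_Iic)]
  have hk : Measurable fun w : Fin n → ℝ => ENNReal.ofReal (mvPhi k V (x + Bᵀ *ᵥ w)) :=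
    ((measurable_mvPhi k hV).comp (by fun_prop)).ennreal_ofReal
  have e : ∀ w : Fin n → ℝ, gV k V (Prod.mk w ⁻¹' ((fun p : (Fin n → ℝ) × (Fin k → ℝ) => p.2 - Bᵀ *ᵥ p.1) ⁻¹' Set.Iic x))
      = ENNReal.ofReal (mvPhi k V (x + Bᵀ *ᵥ w)) := by
    intro w
    rw [ofReal_mvPhi k hV]
    congr 1
    ext y
    simp
  simp_rw [e]
  rw [gV, lintegral_withDensity_eq_lintegral_mul _ (measurable_ofReal_mvphi n 1) hk]
  rfl

/-- CFUSN density. -/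
noncomputable def fD (k m : ℕ) (D : Matrix (Fin k) (Fin m) ℝ) (z : Fin k → ℝ) : ℝ :=
  2 ^ m * mvphi k 1 z * mvPhi m (1 - Dᵀ * D) (Dᵀ *ᵥ z)

/-- log-density of the log-variable, in the original coordinates. -/
noncomputable def hD (k m : ℕ) (D : Matrix (Fin k) (Fin m) ℝ) (z : Fin k → ℝ) : ℝ :=
  Real.log (fD k m D z) - ∑ i, z i

lemma mvphi_one_pos (k : ℕ) (z : Fin k → ℝ) : 0 < mvphi k 1 z := by
  rw [mvphi_one_eq]; positivity

lemma fD_pos (k m : ℕ) {D : Matrix (Fin k) (Fin m) ℝ} (h : (1 - Dᵀ * D).PosDef) (z) :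
    0 < fD k m D z := by
  have h1 := mvphi_one_pos k z
  have h2 := mvPhi_pos m h (Dᵀ *ᵥ z)
  unfold fD; positivity

lemma measurable_fD (k m : ℕ) {D : Matrix (Fin k) (Fin m) ℝ} (h : (1 - Dᵀ * D).PosDef) :
    Measurable (fD k m D) := by
  unfold fD
  have h2 : Measurable fun z : Fin k → ℝ => mvPhi m (1 - Dᵀ * D) (Dᵀ *ᵥ z) :=
    (measurable_mvPhi m h).comp (by fun_prop)
  exact ((continuous_mvphi k 1).measurable.const_mul _).mul h2

lemma measurable_hD (k m : ℕ) {D : Matrix (Fin k) (Fin m) ℝ} (h : (1 - Dᵀ * D).PosDef) :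
    Measurable (hD k m D) := by
  unfold hD
  exact (Real.measurable_log.comp (measurable_fD k m h)).sub (by fun_prop)

lemma hD_eq (k m : ℕ) {D : Matrix (Fin k) (Fin m) ℝ} (h : (1 - Dᵀ * D).PosDef) (z) :
    hD k m D z = m * Real.log 2 + Real.log (mvphi k 1 z)
      + Real.log (mvPhi m (1 - Dᵀ * D) (Dᵀ *ᵥ z)) - ∑ i, z i := by
  have h1 := mvphi_one_pos k z
  have h2 := mvPhi_pos m h (Dᵀ *ᵥ z)
  rw [hD, fD, Real.log_mul (by positivity) h2.ne', Real.log_mul (by positivity) h1.ne', Real.log_pow]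

lemma log_mvphi_one (k : ℕ) (z : Fin k → ℝ) :
    Real.log (mvphi k 1 z) = (-(k : ℝ) / 2) * Real.log (2 * Real.pi) - 1/2 * ∑ i, z i ^ 2 := by
  rw [mvphi_one_eq, Real.log_mul (by positivity) (by positivity), Real.log_exp,
    Real.log_rpow (by positivity)]
  ring

lemma integrable_fD_hD (k m : ℕ) {D : Matrix (Fin k) (Fin m) ℝ} (h : (1 - Dᵀ * D).PosDef) :
    Integrable (fun z => fD k m D z * hD k m D z) := by
  set c : ℝ := m * Real.log 2 + (-(k : ℝ) / 2) * Real.log (2 * Real.pi) with hc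
  set a : ℝ := (2 * Real.pi) ^ (-(k : ℝ) / 2) with ha
  have ha0 : 0 ≤ a := by positivity
  refine Integrable.mono'
    ((integrable_exp_neg_sum k (b := 1/4) (by norm_num)).const_mul (2 ^ m * a * (|c| + k + 1 + 3)))
    ((measurable_fD k m h).mul (measurable_hD k m h)).aestronglyMeasurable
    (Filter.Eventually.of_forall fun z => ?_)
  have h2 := mvPhi_pos m h (Dᵀ *ᵥ z)
  have h3 := mvPhi_le_one m h (Dᵀ *ᵥ z)
  have h1 := mvphi_one_pos k z
  set P := mvPhi m (1 - Dᵀ * D) (Dᵀ *ᵥ z)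
  set s := ∑ i, z i ^ 2 with hs
  have hs0 : 0 ≤ s := Finset.sum_nonneg fun i _ => sq_nonneg _
  have e : fD k m D z * hD k m D z
      = 2 ^ m * mvphi k 1 z * (P * (c - 1/2 * s - ∑ i, z i) + P * Real.log P) := by
    rw [hD_eq k m h, log_mvphi_one, fD]
    ring
  have hsum : |∑ i, z i| ≤ 1/4 * s + k := by
    calc |∑ i, z i| ≤ ∑ i, |z i| := Finset.abs_sum_le_sum_abs _ _
      _ ≤ ∑ i, (1/4 * z i ^ 2 + 1) := by
        refine Finset.sum_le_sum fun i _ => ?_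
        rw [← sq_abs]
        nlinarith [sq_nonneg (|z i| / 2 - 1)]
      _ = 1/4 * s + k := by
        rw [Finset.sum_add_distrib, ← Finset.mul_sum]; simp [hs]
  have hplog : |P * Real.log P| ≤ 1 := by
    have h4 := Real.abs_log_mul_self_lt P h2 h3
    rw [mul_comm]
    exact h4.le
  have hq : |c - 1/2 * s - ∑ i, z i| ≤ |c| + k + 3/4 * s := by
    have := abs_sub (c - 1/2 * s) (∑ i, z i)
    have h5 := abs_sub c (1/2 * s)
    rw [abs_of_nonneg (by positivity : 0 ≤ 1/2 * s)] at h5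
    linarith
  have hin : |P * (c - 1/2 * s - ∑ i, z i) + P * Real.log P|
      ≤ (|c| + k + 1 + 3) * Real.exp (1/4 * s) := by
    have h6 := abs_add_le (P * (c - 1/2 * s - ∑ i, z i)) (P * Real.log P)
    have h7 : |P * (c - 1/2 * s - ∑ i, z i)| ≤ |c| + k + 3/4 * s := by
      rw [abs_mul, abs_of_pos h2]
      exact (mul_le_of_le_one_left (abs_nonneg _) h3).trans hq
    have h8 : 1/4 * s + 1 ≤ Real.exp (1/4 * s) := Real.add_one_le_exp _
    have h9 : 1 ≤ Real.exp (1/4 * s) := by linarith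
    have h10 : 0 ≤ |c| + k + 1 := by positivity
    nlinarith
  rw [e, Real.norm_eq_abs, abs_mul, abs_of_pos (by positivity)]
  calc 2 ^ m * mvphi k 1 z * |P * (c - 1/2 * s - ∑ i, z i) + P * Real.log P|
      ≤ 2 ^ m * mvphi k 1 z * ((|c| + k + 1 + 3) * Real.exp (1/4 * s)) := by gcongr
    _ = 2 ^ m * a * (|c| + k + 1 + 3) * (Real.exp (-(1/2) * s) * Real.exp (1/4 * s)) := by
        rw [mvphi_one_eq]; ring
    _ = 2 ^ m * a * (|c| + k + 1 + 3) * Real.exp (-(1/4) * s) := by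
        rw [← Real.exp_add]; congr 2; ring

lemma integral_exp_change (k : ℕ) (F : (Fin k → ℝ) → ℝ)
    (hF : ∀ u : Fin k → ℝ, ¬ (∀ i, 0 < u i) → F u = 0) :
    ∫ u, F u = ∫ z : Fin k → ℝ, (∏ i, Real.exp (z i)) * F (fun i => Real.exp (z i)) := by
  set f : (Fin k → ℝ) → (Fin k → ℝ) := fun z i => Real.exp (z i) with hf
  set f' : (Fin k → ℝ) → ((Fin k → ℝ) →L[ℝ] (Fin k → ℝ)) := fun z =>
    ContinuousLinearMap.pi fun i => Real.exp (z i) • ContinuousLinearMap.proj i with hf'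
  have hd : ∀ z ∈ Set.univ, HasFDerivWithinAt f (f' z) Set.univ z := by
    intro z _
    rw [hasFDerivWithinAt_pi]
    intro i
    exact ((hasFDerivAt_apply i z).exp).hasFDerivWithinAt
  have hinj : Set.InjOn f Set.univ := by
    intro x _ y _ hxy
    funext i
    exact Real.exp_injective (congrFun hxy i)
  have himg : f '' Set.univ = {u | ∀ i, 0 < u i} := by
    ext u
    constructor
    · rintro ⟨z, -, rfl⟩ i
      exact Real.exp_pos _
    · intro hu
      exact ⟨fun i => Real.log (u i), trivial, funext fun i => Real.exp_log (hu i)⟩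
  have hdet : ∀ z, (f' z).det = ∏ i, Real.exp (z i) := by
    intro z
    have : ((f' z : (Fin k → ℝ) →L[ℝ] (Fin k → ℝ)) : (Fin k → ℝ) →ₗ[ℝ] (Fin k → ℝ))
        = Matrix.toLin' (Matrix.diagonal fun i => Real.exp (z i)) := by
      ext v i
      simp [hf', Matrix.mulVec_diagonal, Pi.single_apply]
    rw [ContinuousLinearMap.det, this, LinearMap.det_toLin', Matrix.det_diagonal]
  have key := integral_image_eq_integral_abs_det_fderiv_smul volume MeasurableSet.univ hd hinj F
  rw [himg, setIntegral_eq_integral_of_forall_compl_eq_zero (s := {u : Fin k → ℝ | ∀ i, 0 < u i}) (fun u hu => hF u hu)] at key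
  rw [key, Measure.restrict_univ]
  refine integral_congr_ae (Filter.Eventually.of_forall fun z => ?_)
  simp only [hdet, smul_eq_mul]
  rw [abs_of_pos (Finset.prod_pos fun i _ => Real.exp_pos _)]

lemma entropy_change (k m : ℕ) {D : Matrix (Fin k) (Fin m) ℝ} (h : (1 - Dᵀ * D).PosDef)
    (F : (Fin k → ℝ) → ℝ)
    (hF : ∀ u : Fin k → ℝ, (∀ i, 0 < u i) →
      F u = (∏ i, u i)⁻¹ * fD k m D (fun i => Real.log (u i)))
    (hF0 : ∀ u : Fin k → ℝ, ¬ (∀ i, 0 < u i) → F u = 0) :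
    ∫ u, F u * Real.log (F u) = ∫ z, fD k m D z * hD k m D z := by
  rw [integral_exp_change k _ (fun u hu => by rw [hF0 u hu, zero_mul])]
  refine integral_congr_ae (Filter.Eventually.of_forall fun z => ?_)
  simp only
  have hp : 0 < ∏ i, Real.exp (z i) := Finset.prod_pos fun i _ => Real.exp_pos _
  have hf := fD_pos k m h z
  rw [hF _ (fun i => Real.exp_pos _)]
  simp only [Real.log_exp]
  rw [Real.log_mul (by positivity) hf.ne', Real.log_inv, ← Real.exp_sum, Real.log_exp, hD,
    Real.exp_sum]
  field_simp
  ring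

lemma lintegral_append (n₁ n₂ : ℕ) (G : (Fin (n₁ + n₂) → ℝ) → ENNReal) (hG : Measurable G) :
    ∫⁻ z, G z = ∫⁻ p : (Fin n₁ → ℝ) × (Fin n₂ → ℝ), G (Fin.append p.1 p.2) := by
  have h1 := volume_measurePreserving_sumPiEquivProdPi_symm (fun _ : Fin n₁ ⊕ Fin n₂ => ℝ)
  have h2 := volume_measurePreserving_piCongrLeft (fun _ : Fin (n₁ + n₂) => ℝ) finSumFinEquiv
  rw [← (h2.comp h1).lintegral_comp hG]
  refine lintegral_congr fun p => ?_
  congr 1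
  funext i
  refine Fin.addCases (fun j => ?_) (fun j => ?_) i
  · rw [Fin.append_left, ← finSumFinEquiv_apply_left, Function.comp_apply,
      MeasurableEquiv.coe_piCongrLeft, Equiv.piCongrLeft_apply_apply]
    rfl
  · rw [Fin.append_right, ← finSumFinEquiv_apply_right, Function.comp_apply,
      MeasurableEquiv.coe_piCongrLeft, Equiv.piCongrLeft_apply_apply]
    rfl

lemma posDef_of_contraction (n m : ℕ) {D : Matrix (Fin n) (Fin m) ℝ}
    (hD : ∀ a : Fin m → ℝ, a ⬝ᵥ a = 1 → (D *ᵥ a) ⬝ᵥ (D *ᵥ a) < 1) : (1 - Dᵀ * D).PosDef := by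
  refine Matrix.PosDef.of_dotProduct_mulVec_pos ?_ fun x hx => ?_
  · rw [Matrix.IsHermitian, conjTranspose_eq_transpose_of_trivial]
    simp
  · rw [star_trivial, sub_mulVec, one_mulVec, dotProduct_sub, ← mulVec_mulVec,
      dotProduct_mulVec x Dᵀ, vecMul_transpose]
    have h0 : 0 < x ⬝ᵥ x := by
      simpa using (dotProduct_star_self_pos_iff (v := x)).mpr hx
    have h1 := hD ((Real.sqrt (x ⬝ᵥ x))⁻¹ • x) (by
      rw [smul_dotProduct, dotProduct_smul, smul_eq_mul, smul_eq_mul, ← mul_assoc, ← mul_inv,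
        Real.mul_self_sqrt h0.le, inv_mul_cancel₀ h0.ne'])
    rw [mulVec_smul, smul_dotProduct, dotProduct_smul, smul_eq_mul, smul_eq_mul, ← mul_assoc,
      ← mul_inv, Real.mul_self_sqrt h0.le, inv_mul_lt_one₀ h0] at h1
    linarith

lemma posSemidef_gram {n m : ℕ} (B : Matrix (Fin n) (Fin m) ℝ) : (Bᵀ * B).PosSemidef := by
  have := Matrix.posSemidef_conjTranspose_mul_self B
  rwa [conjTranspose_eq_transpose_of_trivial] at this

section blocks
variable {n₁ n₂ m : ℕ} (Δ : Matrix (Fin (n₁ + n₂)) (Fin m) ℝ)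
    {Δ₁ : Matrix (Fin n₁) (Fin m) ℝ} {Δ₂ : Matrix (Fin n₂) (Fin m) ℝ}

lemma gram_split (hΔ₁ : ∀ i j, Δ₁ i j = Δ (Fin.castAdd n₂ i) j)
    (hΔ₂ : ∀ i j, Δ₂ i j = Δ (Fin.natAdd n₁ i) j) : Δᵀ * Δ = Δ₁ᵀ * Δ₁ + Δ₂ᵀ * Δ₂ := by
  ext i j
  simp [Matrix.mul_apply, Fin.sum_univ_add, hΔ₁, hΔ₂]

lemma fD_append (hΔ₁ : ∀ i j, Δ₁ i j = Δ (Fin.castAdd n₂ i) j)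
    (hΔ₂ : ∀ i j, Δ₂ i j = Δ (Fin.natAdd n₁ i) j) (a : Fin n₁ → ℝ) (b : Fin n₂ → ℝ) :
    fD (n₁ + n₂) m Δ (Fin.append a b) = 2 ^ m * mvphi n₁ 1 a * mvphi n₂ 1 b *
      mvPhi m (1 - Δᵀ * Δ) (Δ₁ᵀ *ᵥ a + Δ₂ᵀ *ᵥ b) := by
  have h1 : Δᵀ *ᵥ (Fin.append a b) = Δ₁ᵀ *ᵥ a + Δ₂ᵀ *ᵥ b := by
    ext j
    simp [mulVec, dotProduct, Fin.sum_univ_add, hΔ₁, hΔ₂]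
  have h2 : mvphi (n₁ + n₂) 1 (Fin.append a b) = mvphi n₁ 1 a * mvphi n₂ 1 b := by
    rw [mvphi_one_eq, mvphi_one_eq, mvphi_one_eq, Fin.sum_univ_add]
    simp only [Fin.append_left, Fin.append_right]
    rw [mul_add, Real.exp_add]
    have : -((n₁ + n₂ : ℕ) : ℝ) / 2 = -(n₁ : ℝ) / 2 + -(n₂ : ℝ) / 2 := by push_cast; ring
    rw [this, Real.rpow_add (by positivity)]
    ring
  rw [fD, h1, h2]
  ring

lemma ofReal_fD_append (hΔ₁ : ∀ i j, Δ₁ i j = Δ (Fin.castAdd n₂ i) j)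
    (hΔ₂ : ∀ i j, Δ₂ i j = Δ (Fin.natAdd n₁ i) j) (a : Fin n₁ → ℝ) (b : Fin n₂ → ℝ) :
    ENNReal.ofReal (fD (n₁ + n₂) m Δ (Fin.append a b)) =
      ENNReal.ofReal (2 ^ m) * ENNReal.ofReal (mvphi n₁ 1 a) * ENNReal.ofReal (mvphi n₂ 1 b) *
      ENNReal.ofReal (mvPhi m (1 - Δᵀ * Δ) (Δ₁ᵀ *ᵥ a + Δ₂ᵀ *ᵥ b)) := by
  have := mvphi_nonneg n₁ 1 a
  have := mvphi_nonneg n₂ 1 b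
  rw [fD_append Δ hΔ₁ hΔ₂, ENNReal.ofReal_mul (by positivity), ENNReal.ofReal_mul (by positivity),
    ENNReal.ofReal_mul (by positivity)]

lemma marg_left (hΔ₁ : ∀ i j, Δ₁ i j = Δ (Fin.castAdd n₂ i) j)
    (hΔ₂ : ∀ i j, Δ₂ i j = Δ (Fin.natAdd n₁ i) j)
    (hV : (1 - Δᵀ * Δ).PosDef) (hV₁ : (1 - Δ₁ᵀ * Δ₁).PosDef)
    (g : (Fin n₁ → ℝ) → ENNReal) (hg : Measurable g) :
    ∫⁻ z, ENNReal.ofReal (fD (n₁ + n₂) m Δ z) * g (fun i => z (Fin.castAdd n₂ i))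
      = ∫⁻ a, ENNReal.ofReal (fD n₁ m Δ₁ a) * g a := by
  have e₁ : (1 - Δᵀ * Δ) + Δ₂ᵀ * Δ₂ = 1 - Δ₁ᵀ * Δ₁ := by rw [gram_split Δ hΔ₁ hΔ₂]; abel
  have hm : Measurable fun z => ENNReal.ofReal (fD (n₁ + n₂) m Δ z) * g (fun i => z (Fin.castAdd n₂ i)) :=
    (measurable_fD _ _ hV).ennreal_ofReal.mul (hg.comp (by fun_prop))
  have hap : Measurable fun p : (Fin n₁ → ℝ) × (Fin n₂ → ℝ) => Fin.append p.1 p.2 := by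
    rw [measurable_pi_iff]
    intro i
    refine Fin.addCases (fun j => ?_) (fun j => ?_) i
    · simp only [Fin.append_left]; fun_prop
    · simp only [Fin.append_right]; fun_prop
  rw [lintegral_append n₁ n₂ _ hm, Measure.volume_eq_prod]
  refine (lintegral_prod _ (hm.comp hap).aemeasurable).trans ?_
  refine lintegral_congr fun a => ?_
  simp only [Function.comp_apply, Fin.append_left]
  have hk : Measurable fun b : Fin n₂ → ℝ => ENNReal.ofReal (mvphi n₂ 1 b) *
      ENNReal.ofReal (mvPhi m (1 - Δᵀ * Δ) (Δ₁ᵀ *ᵥ a + Δ₂ᵀ *ᵥ b)) :=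
    (measurable_ofReal_mvphi n₂ 1).mul
      ((measurable_mvPhi m hV).comp (by fun_prop)).ennreal_ofReal
  have e : ∀ b, ENNReal.ofReal (fD (n₁ + n₂) m Δ (Fin.append a b)) * g a =
      (ENNReal.ofReal (2 ^ m) * ENNReal.ofReal (mvphi n₁ 1 a) * g a) *
      (ENNReal.ofReal (mvphi n₂ 1 b) *
      ENNReal.ofReal (mvPhi m (1 - Δᵀ * Δ) (Δ₁ᵀ *ᵥ a + Δ₂ᵀ *ᵥ b))) := by
    intro b
    rw [ofReal_fD_append Δ hΔ₁ hΔ₂]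
    ring
  simp_rw [e]
  rw [lintegral_const_mul _ hk, marginal_mvPhi n₂ m hV Δ₂ (by rw [e₁]; exact hV₁), e₁]
  have := mvphi_nonneg n₁ 1 a
  rw [fD, ENNReal.ofReal_mul (by positivity), ENNReal.ofReal_mul (by positivity)]
  ring

lemma marg_right (hΔ₁ : ∀ i j, Δ₁ i j = Δ (Fin.castAdd n₂ i) j)
    (hΔ₂ : ∀ i j, Δ₂ i j = Δ (Fin.natAdd n₁ i) j)
    (hV : (1 - Δᵀ * Δ).PosDef) (hV₂ : (1 - Δ₂ᵀ * Δ₂).PosDef)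
    (g : (Fin n₂ → ℝ) → ENNReal) (hg : Measurable g) :
    ∫⁻ z, ENNReal.ofReal (fD (n₁ + n₂) m Δ z) * g (fun i => z (Fin.natAdd n₁ i))
      = ∫⁻ b, ENNReal.ofReal (fD n₂ m Δ₂ b) * g b := by
  have e₂ : (1 - Δᵀ * Δ) + Δ₁ᵀ * Δ₁ = 1 - Δ₂ᵀ * Δ₂ := by rw [gram_split Δ hΔ₁ hΔ₂]; abel
  have hm : Measurable fun z => ENNReal.ofReal (fD (n₁ + n₂) m Δ z) * g (fun i => z (Fin.natAdd n₁ i)) :=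
    (measurable_fD _ _ hV).ennreal_ofReal.mul (hg.comp (by fun_prop))
  have hap : Measurable fun p : (Fin n₁ → ℝ) × (Fin n₂ → ℝ) => Fin.append p.1 p.2 := by
    rw [measurable_pi_iff]
    intro i
    refine Fin.addCases (fun j => ?_) (fun j => ?_) i
    · simp only [Fin.append_left]; fun_prop
    · simp only [Fin.append_right]; fun_prop
  rw [lintegral_append n₁ n₂ _ hm, Measure.volume_eq_prod]
  refine (lintegral_prod_symm _ (hm.comp hap).aemeasurable).trans ?_
  refine lintegral_congr fun b => ?_
  simp only [Function.comp_apply, Fin.append_right]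
  have hk : Measurable fun a : Fin n₁ → ℝ => ENNReal.ofReal (mvphi n₁ 1 a) *
      ENNReal.ofReal (mvPhi m (1 - Δᵀ * Δ) (Δ₂ᵀ *ᵥ b + Δ₁ᵀ *ᵥ a)) :=
    (measurable_ofReal_mvphi n₁ 1).mul
      ((measurable_mvPhi m hV).comp (by fun_prop)).ennreal_ofReal
  have e : ∀ a, ENNReal.ofReal (fD (n₁ + n₂) m Δ (Fin.append a b)) * g b =
      (ENNReal.ofReal (2 ^ m) * ENNReal.ofReal (mvphi n₂ 1 b) * g b) *
      (ENNReal.ofReal (mvphi n₁ 1 a) *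
      ENNReal.ofReal (mvPhi m (1 - Δᵀ * Δ) (Δ₂ᵀ *ᵥ b + Δ₁ᵀ *ᵥ a))) := by
    intro a
    rw [ofReal_fD_append Δ hΔ₁ hΔ₂, add_comm (Δ₂ᵀ *ᵥ b)]
    ring
  simp_rw [e]
  rw [lintegral_const_mul _ hk, marginal_mvPhi n₁ m hV Δ₁ (by rw [e₂]; exact hV₂), e₂]
  have := mvphi_nonneg n₂ 1 b
  rw [fD, ENNReal.ofReal_mul (by positivity), ENNReal.ofReal_mul (by positivity)]
  ring

end blocks

lemma transfer {n k : ℕ} (f : (Fin n → ℝ) → ℝ) (f₁ : (Fin k → ℝ) → ℝ)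
    (π₁ : (Fin n → ℝ) → (Fin k → ℝ)) (hf : Measurable f) (hf₁ : Measurable f₁)
    (hp : ∀ z, 0 ≤ f z) (hp₁ : ∀ z, 0 ≤ f₁ z) (hπ : Measurable π₁)
    (h : ∀ g : (Fin k → ℝ) → ENNReal, Measurable g →
      ∫⁻ z, ENNReal.ofReal (f z) * g (π₁ z) = ∫⁻ a, ENNReal.ofReal (f₁ a) * g a)
    (g : (Fin k → ℝ) → ℝ) (hg : Measurable g) (hi : Integrable fun a => f₁ a * g a) :
    Integrable (fun z => f z * g (π₁ z)) ∧ ∫ z, f z * g (π₁ z) = ∫ a, f₁ a * g a := by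
  have hmap : (volume.withDensity fun z => ENNReal.ofReal (f z)).map π₁
      = volume.withDensity fun a => ENNReal.ofReal (f₁ a) := by
    ext s hs
    rw [Measure.map_apply hπ hs, withDensity_apply _ (hπ hs), withDensity_apply _ hs,
      ← lintegral_indicator (hπ hs), ← lintegral_indicator hs]
    have := h (s.indicator 1) (measurable_one.indicator hs)
    refine (lintegral_congr fun z => ?_).trans (this.trans (lintegral_congr fun z => ?_))
    · by_cases hz : π₁ z ∈ s <;> simp [hz]
    · by_cases hz : z ∈ s <;> simp [hz]
  have a1 : ∀ z, (ENNReal.ofReal (f z)).toReal = f z := fun z => ENNReal.toReal_ofReal (hp z)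
  have a2 : ∀ z, (ENNReal.ofReal (f₁ z)).toReal = f₁ z := fun z => ENNReal.toReal_ofReal (hp₁ z)
  have i1 : Integrable g (volume.withDensity fun a => ENNReal.ofReal (f₁ a)) := by
    rw [integrable_withDensity_iff_integrable_smul' hf₁.ennreal_ofReal
      (Filter.Eventually.of_forall fun _ => ENNReal.ofReal_lt_top)]
    simpa [a2] using hi
  constructor
  · rw [← hmap, integrable_map_measure hg.aestronglyMeasurable hπ.aemeasurable,
      integrable_withDensity_iff_integrable_smul' hf.ennreal_ofReal
      (Filter.Eventually.of_forall fun _ => ENNReal.ofReal_lt_top)] at i1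
    simpa [a1] using i1
  · have k1 := integral_withDensity_eq_integral_toReal_smul (μ := volume) hf.ennreal_ofReal
      (Filter.Eventually.of_forall fun _ => ENNReal.ofReal_lt_top) (fun z => g (π₁ z))
    have k2 := integral_withDensity_eq_integral_toReal_smul (μ := volume) hf₁.ennreal_ofReal
      (Filter.Eventually.of_forall fun _ => ENNReal.ofReal_lt_top) g
    simp only [a1, a2, smul_eq_mul] at k1 k2
    rw [← k1, ← k2, ← hmap, integral_map hπ.aemeasurable hg.aestronglyMeasurable]

/-- Mutual information between the two blocks `Z₁, Z₂` of `Z = exp(X) ~ LCFUSN_{n₁+n₂,m}(Δ)`,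
where `X ~ CFUSN_{n₁+n₂,m}(Δ)` is partitioned as `(X₁, X₂)` and `Δ` as `(Δ₁; Δ₂)`:
`I_{Z₁,Z₂} = E[ln(Φ_m(Δ'X|I−Δ'Δ) / (2^m Φ_m(Δ₁'X₁|I−Δ₁'Δ₁) Φ_m(Δ₂'X₂|I−Δ₂'Δ₂)))]`. -/
theorem mutual_information_LCFUSN (n₁ n₂ m : ℕ)
    (Δ : Matrix (Fin (n₁ + n₂)) (Fin m) ℝ)
    (hΔ : ∀ a : Fin m → ℝ, a ⬝ᵥ a = 1 → (Δ *ᵥ a) ⬝ᵥ (Δ *ᵥ a) < 1)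
    (Δ₁ : Matrix (Fin n₁) (Fin m) ℝ) (Δ₂ : Matrix (Fin n₂) (Fin m) ℝ)
    (hΔ₁ : ∀ i j, Δ₁ i j = Δ (Fin.castAdd n₂ i) j)
    (hΔ₂ : ∀ i j, Δ₂ i j = Δ (Fin.natAdd n₁ i) j)
    (f₀ : (Fin (n₁ + n₂) → ℝ) → ℝ)
    (hf₀ : ∀ z, f₀ z = 2 ^ m * mvphi (n₁ + n₂) 1 z * mvPhi m (1 - Δᵀ * Δ) (Δᵀ *ᵥ z))
    (fZ : (Fin (n₁ + n₂) → ℝ) → ℝ)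
    (hfZ : ∀ u : Fin (n₁ + n₂) → ℝ, (∀ i, 0 < u i) →
      fZ u = (∏ i, u i)⁻¹ * f₀ (fun i => Real.log (u i)))
    (hfZ0 : ∀ u : Fin (n₁ + n₂) → ℝ, ¬ (∀ i, 0 < u i) → fZ u = 0)
    (fZ₁ : (Fin n₁ → ℝ) → ℝ)
    (hfZ₁ : ∀ u : Fin n₁ → ℝ, (∀ i, 0 < u i) →
      fZ₁ u = 2 ^ m * (∏ i, u i)⁻¹ * mvphi n₁ 1 (fun i => Real.log (u i)) *
        mvPhi m (1 - Δ₁ᵀ * Δ₁) (Δ₁ᵀ *ᵥ fun i => Real.log (u i)))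
    (hfZ₁0 : ∀ u : Fin n₁ → ℝ, ¬ (∀ i, 0 < u i) → fZ₁ u = 0)
    (fZ₂ : (Fin n₂ → ℝ) → ℝ)
    (hfZ₂ : ∀ u : Fin n₂ → ℝ, (∀ i, 0 < u i) →
      fZ₂ u = 2 ^ m * (∏ i, u i)⁻¹ * mvphi n₂ 1 (fun i => Real.log (u i)) *
        mvPhi m (1 - Δ₂ᵀ * Δ₂) (Δ₂ᵀ *ᵥ fun i => Real.log (u i)))
    (hfZ₂0 : ∀ u : Fin n₂ → ℝ, ¬ (∀ i, 0 < u i) → fZ₂ u = 0) :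
    (-∫ u, fZ₁ u * Real.log (fZ₁ u)) + (-∫ u, fZ₂ u * Real.log (fZ₂ u))
        - (-∫ u, fZ u * Real.log (fZ u)) =
      ∫ z, f₀ z * Real.log (mvPhi m (1 - Δᵀ * Δ) (Δᵀ *ᵥ z) /
        (2 ^ m * mvPhi m (1 - Δ₁ᵀ * Δ₁) (Δ₁ᵀ *ᵥ fun i => z (Fin.castAdd n₂ i))
          * mvPhi m (1 - Δ₂ᵀ * Δ₂) (Δ₂ᵀ *ᵥ fun i => z (Fin.natAdd n₁ i)))) := by
  have hV : (1 - Δᵀ * Δ).PosDef := posDef_of_contraction _ _ hΔ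
  have hs := gram_split Δ hΔ₁ hΔ₂
  have e₁ : (1 - Δᵀ * Δ) + Δ₂ᵀ * Δ₂ = 1 - Δ₁ᵀ * Δ₁ := by rw [hs]; abel
  have e₂ : (1 - Δᵀ * Δ) + Δ₁ᵀ * Δ₁ = 1 - Δ₂ᵀ * Δ₂ := by rw [hs]; abel
  have hV₁ : (1 - Δ₁ᵀ * Δ₁).PosDef := by
    rw [← e₁]; exact hV.add_posSemidef (posSemidef_gram Δ₂)
  have hV₂ : (1 - Δ₂ᵀ * Δ₂).PosDef := by
    rw [← e₂]; exact hV.add_posSemidef (posSemidef_gram Δ₁)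
  have hf : f₀ = fD (n₁ + n₂) m Δ := funext hf₀
  subst hf
  rw [entropy_change _ _ hV fZ hfZ hfZ0,
    entropy_change _ _ hV₁ fZ₁ (fun u hu => by rw [hfZ₁ u hu, fD]; ring) hfZ₁0,
    entropy_change _ _ hV₂ fZ₂ (fun u hu => by rw [hfZ₂ u hu, fD]; ring) hfZ₂0]
  obtain ⟨i₁, j₁⟩ := transfer (fD (n₁ + n₂) m Δ) (fD n₁ m Δ₁) (fun z i => z (Fin.castAdd n₂ i))
    (measurable_fD _ _ hV) (measurable_fD _ _ hV₁) (fun z => (fD_pos _ _ hV z).le)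
    (fun z => (fD_pos _ _ hV₁ z).le) (by fun_prop)
    (fun g hg => marg_left Δ hΔ₁ hΔ₂ hV hV₁ g hg) (hD n₁ m Δ₁) (measurable_hD _ _ hV₁)
    (integrable_fD_hD _ _ hV₁)
  obtain ⟨i₂, j₂⟩ := transfer (fD (n₁ + n₂) m Δ) (fD n₂ m Δ₂) (fun z i => z (Fin.natAdd n₁ i))
    (measurable_fD _ _ hV) (measurable_fD _ _ hV₂) (fun z => (fD_pos _ _ hV z).le)
    (fun z => (fD_pos _ _ hV₂ z).le) (by fun_prop)
    (fun g hg => marg_right Δ hΔ₁ hΔ₂ hV hV₂ g hg) (hD n₂ m Δ₂) (measurable_hD _ _ hV₂)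
    (integrable_fD_hD _ _ hV₂)
  have i₀ := integrable_fD_hD _ _ hV
  rw [← j₁, ← j₂]
  have := integral_sub (i₀.sub i₁) i₂
  have h2 := integral_sub i₀ i₁
  simp only [Pi.sub_apply] at this
  rw [h2] at this
  rw [show ∀ a b c : ℝ, -a + -b - -c = c - a - b from fun a b c => by ring, ← this]
  refine integral_congr_ae (Filter.Eventually.of_forall fun z => ?_)
  simp only
  rw [hD_eq _ _ hV, hD_eq _ _ hV₁, hD_eq _ _ hV₂, log_mvphi_one, log_mvphi_one, log_mvphi_one,
    Fin.sum_univ_add, Fin.sum_univ_add]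
  have p₀ := mvPhi_pos m hV (Δᵀ *ᵥ z)
  have p₁ := mvPhi_pos m hV₁ (Δ₁ᵀ *ᵥ fun i => z (Fin.castAdd n₂ i))
  have p₂ := mvPhi_pos m hV₂ (Δ₂ᵀ *ᵥ fun i => z (Fin.natAdd n₁ i))
  rw [Real.log_div p₀.ne' (by positivity), Real.log_mul (by positivity) p₂.ne',
    Real.log_mul (by positivity) p₁.ne', Real.log_pow]
  push_cast
  ring
end
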